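/- arXiv:2407.19999 — 8 statements merged into one kernel-verified Lean document; each statement's English description precedes it below -/
import Mathlib

section
/- Let R be a commutative Noetherian local ring and M a finitely generated R-module. Then the stable annihilator of M is contained in the stable annihilator of any syzygy of M, i.e., ann_R(Ext^1_R(M, ΩM)) ⊆ ann_R(Ext^1_R(ΩM, Ω²M)). -/
open CategoryTheory Opposite IsLocalRing

universe u

variable (R : Type u) [CommRing R]

/-- The Ext module `Ext^i_R(M, N)` as an object of `ModuleCat R`. -/
noncomputable def ExtMod (i : ℕ) (M N : Type u) [AddCommGroup M] [Module R M]
    [AddCommGroup N] [Module R N] : ModuleCat.{u} R :=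
  ((Ext R (ModuleCat.{u} R) i).obj (op (ModuleCat.of R M))).obj (ModuleCat.of R N)

/-- The annihilator of `Ext^i_R(M, N)`. -/
noncomputable def extAnn (i : ℕ) (M N : Type u) [AddCommGroup M] [Module R M]
    [AddCommGroup N] [Module R N] : Ideal R :=
  Module.annihilator R (ExtMod R i M N)

/-- `S` is a (first) syzygy of `M`: the kernel of a surjection from a
finitely generated free module onto `M`. -/
def IsSyzygy (M S : Type u) [AddCommGroup M] [Module R M] [AddCommGroup S] [Module R S] : Prop :=
  ∃ (F : Type u) (_ : AddCommGroup F) (_ : Module R F) (ι : S →ₗ[R] F) (π : F →ₗ[R] M),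
    Module.Free R F ∧ Module.Finite R F ∧ Function.Injective ι ∧ Function.Surjective π ∧
      LinearMap.range ι = LinearMap.ker π

/-- The submodule of `Hom_R(M,N)` of maps factoring through a free module. -/
def stablyTrivial (M N : Type u) [AddCommGroup M] [Module R M] [AddCommGroup N] [Module R N] :
    Submodule R (M →ₗ[R] N) :=
  Submodule.span R {f : M →ₗ[R] N | ∃ (F : Type u) (_ : AddCommGroup F) (_ : Module R F),
    Module.Free R F ∧ ∃ (g : M →ₗ[R] F) (h : F →ₗ[R] N), h ∘ₗ g = f}

/-- The stable annihilator of `M`: the annihilator of `End_R(M)/P(M,M)`. -/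
noncomputable def stableAnn (M : Type u) [AddCommGroup M] [Module R M] : Ideal R :=
  Module.annihilator R ((M →ₗ[R] M) ⧸ stablyTrivial R M M)

/-- The Auslander–Reiten annihilator `⋂_{i>0} ann Ext^i(M, M ⊕ R)`. -/
noncomputable def ARann (M : Type u) [AddCommGroup M] [Module R M] : Ideal R :=
  ⨅ i : ℕ, extAnn R (i + 1) M (M × R)

/-- Depth of a module over a local ring: supremum of lengths of regular sequences
contained in the maximal ideal. -/
noncomputable def moduleDepth [IsLocalRing R] (M : Type u) [AddCommGroup M] [Module R M] : ℕ∞ :=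
  sSup {n : ℕ∞ | ∃ rs : List R, (∀ r ∈ rs, r ∈ maximalIdeal R) ∧
    RingTheory.Sequence.IsRegular M rs ∧ (rs.length : ℕ∞) = n}

/-- `ω` is a canonical module of the `d`-dimensional Cohen-Macaulay local ring `R`:
it is finitely generated and `Ext^i(k, ω)` vanishes for `i ≠ d` and is `k` for `i = d`. -/
def IsCanonicalModule [IsLocalRing R] (d : ℕ) (ω : Type u) [AddCommGroup ω] [Module R ω] :
    Prop :=
  Module.Finite R ω ∧
    (∀ i : ℕ, i ≠ d → Subsingleton (ExtMod R i (ResidueField R) ω)) ∧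
    Nonempty ((ExtMod R d (ResidueField R) ω) ≃ₗ[R] ResidueField R)

/-- A Gorenstein local ring: Noetherian local, and the ring itself is a canonical module. -/
def IsGorensteinLocal (A : Type u) [CommRing A] [IsLocalRing A] : Prop :=
  IsNoetherianRing A ∧ ∃ d : ℕ, ringKrullDim A = d ∧ IsCanonicalModule A d A

/-- A regular local ring: Noetherian local whose maximal ideal is generated by
`dim` elements. -/
def IsRegularLocal (A : Type u) [CommRing A] [IsLocalRing A] : Prop :=
  IsNoetherianRing A ∧ ∃ (d : ℕ) (s : Finset A), ringKrullDim A = (d : ℕ) ∧ s.card = d ∧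
    Ideal.span (s : Set A) = maximalIdeal A

/-- `S` is an `n`-th syzygy of `M`. -/
def IsNthSyzygy : (n : ℕ) → ∀ (M S : Type u) [AddCommGroup M] [Module R M]
    [AddCommGroup S] [Module R S], Prop
  | 0 => fun M S _ _ _ _ => Nonempty (M ≃ₗ[R] S)
  | n + 1 => fun M S _ _ _ _ => ∃ (T : Type u) (_ : AddCommGroup T) (_ : Module R T),
      IsSyzygy R M T ∧ IsNthSyzygy n T S

/-- Maximal Cohen-Macaulay module: finitely generated with depth equal to the
Krull dimension of the ring. -/
def IsMCM [IsLocalRing R] (M : Type u) [AddCommGroup M] [Module R M] : Prop :=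
  Module.Finite R M ∧ (moduleDepth R M : WithBot ℕ∞) = ringKrullDim R

/-- The trace ideal of a module. -/
def traceIdeal (M : Type u) [AddCommGroup M] [Module R M] : Ideal R :=
  ⨆ f : M →ₗ[R] R, LinearMap.range f


lemma mem_ann_homology_iff {R : Type u} [CommRing R] (S : ShortComplex (ModuleCat.{u} R)) (a : R) :
    a ∈ Module.annihilator R S.homology ↔
      ∀ x : S.X₂, S.g x = 0 → ∃ y : S.X₁, S.f y = a • x := by
  rw [LinearEquiv.annihilator_eq (S.moduleCatHomologyIso).toLinearEquiv, Module.mem_annihilator]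
  change (∀ m : (LinearMap.ker S.g.hom ⧸ LinearMap.range S.moduleCatToCycles), a • m = 0) ↔ _
  constructor
  · intro h x hx
    have := h (Submodule.Quotient.mk ⟨x, hx⟩)
    rw [← Submodule.Quotient.mk_smul, Submodule.Quotient.mk_eq_zero] at this
    obtain ⟨y, hy⟩ := this
    exact ⟨y, congrArg Subtype.val hy⟩
  · intro h m
    obtain ⟨⟨x, hx⟩, rfl⟩ := Submodule.Quotient.mk_surjective _ m
    obtain ⟨y, hy⟩ := h x hx
    rw [← Submodule.Quotient.mk_smul, Submodule.Quotient.mk_eq_zero]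
    exact ⟨y, Subtype.ext hy⟩

lemma mem_extAnn_iff {R : Type u} [CommRing R] (M N : Type u) [AddCommGroup M] [Module R M]
    [AddCommGroup N] [Module R N] (P : ProjectiveResolution (ModuleCat.of R M)) (a : R) :
    a ∈ extAnn R 1 M N ↔ ∀ c : P.complex.X 1 ⟶ ModuleCat.of R N, P.complex.d 2 1 ≫ c = 0 →
      ∃ h : P.complex.X 0 ⟶ ModuleCat.of R N, P.complex.d 1 0 ≫ h = a • c := by
  have e : ExtMod R 1 M N ≅
      ((P.complex.linearYonedaObj R (ModuleCat.of R N)).sc' 0 1 2).homology :=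
    P.isoExt 1 (ModuleCat.of R N) ≪≫ ShortComplex.homologyMapIso
      (HomologicalComplex.isoSc' _ 0 1 2 (by simp) (by simp))
  rw [extAnn, LinearEquiv.annihilator_eq e.toLinearEquiv, mem_ann_homology_iff]
  rfl

/-- Data extracted from a projective resolution of a module. -/
lemma exists_res {R : Type u} [CommRing R] (M : Type u) [AddCommGroup M] [Module R M] :
    ∃ (P0 P1 P2 : Type u) (_ : AddCommGroup P0) (_ : AddCommGroup P1) (_ : AddCommGroup P2)
      (_ : Module R P0) (_ : Module R P1) (_ : Module R P2)
      (d2 : P2 →ₗ[R] P1) (d1 : P1 →ₗ[R] P0) (p : P0 →ₗ[R] M),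
      Module.Projective R P0 ∧ Function.Surjective p ∧ Function.Exact d1 p ∧
      Function.Exact d2 d1 ∧
      ∀ (N : Type u) [AddCommGroup N] [Module R N] (a : R),
        a ∈ extAnn R 1 M N ↔ ∀ c : P1 →ₗ[R] N, c ∘ₗ d2 = 0 →
          ∃ h : P0 →ₗ[R] N, h ∘ₗ d1 = a • c := by
  let P := projectiveResolution (ModuleCat.of R M)
  refine ⟨P.complex.X 0, P.complex.X 1, P.complex.X 2, inferInstance, inferInstance,
    inferInstance, inferInstance, inferInstance, inferInstance, (P.complex.d 2 1).hom,
    (P.complex.d 1 0).hom, (P.π.f 0).hom, ?_, ?_, ?_, ?_, ?_⟩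
  · exact (IsProjective.iff_projective _).2 (P.projective 0)
  · exact (ModuleCat.epi_iff_surjective (P.π.f 0)).1 inferInstance
  · exact (ShortComplex.ShortExact.moduleCat_exact_iff_function_exact _).1 P.exact₀
  · exact (ShortComplex.ShortExact.moduleCat_exact_iff_function_exact _).1 (P.exact_succ 0)
  · intro N _ _ a
    rw [mem_extAnn_iff M N P]
    constructor
    · intro H c hc
      obtain ⟨h, hh⟩ := H (ModuleCat.ofHom c) (ModuleCat.hom_ext hc)
      exact ⟨h.hom, congrArg ModuleCat.Hom.hom hh⟩
    · intro H c hc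
      obtain ⟨h, hh⟩ := H c.hom (congrArg ModuleCat.Hom.hom hc)
      exact ⟨ModuleCat.ofHom h, ModuleCat.hom_ext hh⟩

/-- Lifting a map out of a projective through an exact pair. -/
lemma lift_exact {R A B C Q : Type u} [CommRing R] [AddCommGroup A] [Module R A]
    [AddCommGroup B] [Module R B] [AddCommGroup C] [Module R C] [AddCommGroup Q] [Module R Q]
    [Module.Projective R Q] (f : A →ₗ[R] B) (g : B →ₗ[R] C) (hfg : Function.Exact f g)
    (t : Q →ₗ[R] B) (ht : ∀ x, g (t x) = 0) : ∃ s : Q →ₗ[R] A, ∀ x, f (s x) = t x := by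
  obtain ⟨s, hs⟩ := Module.projective_lifting_property f.rangeRestrict
    (t.codRestrict (LinearMap.range f) (fun x => (hfg (t x)).1 (ht x)))
    f.surjective_rangeRestrict
  exact ⟨s, fun x => congrArg Subtype.val (LinearMap.congr_fun hs x)⟩

/-- The stable annihilator of `M` is contained in the stable annihilator of a syzygy
of `M`: `ann Ext¹(M, ΩM) ⊆ ann Ext¹(ΩM, Ω²M)`. -/
theorem stmt0 (R : Type u) [CommRing R] [IsNoetherianRing R] [IsLocalRing R]
    (M S1 S2 : Type u) [AddCommGroup M] [Module R M] [Module.Finite R M]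
    [AddCommGroup S1] [Module R S1] [AddCommGroup S2] [Module R S2]
    (h1 : IsSyzygy R M S1) (h2 : IsSyzygy R S1 S2) :
    extAnn R 1 M S1 ≤ extAnn R 1 S1 S2 := by
  intro a ha
  obtain ⟨F, _, _, ι, π, hF, -, hι, hπ, hex⟩ := h1
  have hex' : Function.Exact ι π := LinearMap.exact_iff.2 hex.symm
  -- step 1: `a • id` extends to `F`
  have key : ∃ h : F →ₗ[R] S1, ∀ s, h (ι s) = a • s := by
    obtain ⟨P0, P1, P2, _, _, _, _, _, _, d2, d1, p, hP, hp, e1, e2, H⟩ := exists_res (R := R) M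
    obtain ⟨f0, hf0⟩ := Module.projective_lifting_property π p hπ
    obtain ⟨g, hg⟩ := Module.projective_lifting_property p π hp
    replace hf0 : ∀ x, π (f0 x) = p x := LinearMap.congr_fun hf0
    replace hg : ∀ x, p (g x) = π x := LinearMap.congr_fun hg
    have hmem : ∀ x, f0 (d1 x) ∈ LinearMap.range ι := fun x => by
      rw [hex, LinearMap.mem_ker, hf0, e1.apply_apply_eq_zero]
    let c : P1 →ₗ[R] S1 := (LinearEquiv.ofInjective ι hι).symm.toLinearMap ∘ₗ
      (f0 ∘ₗ d1).codRestrict (LinearMap.range ι) hmem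
    have hc : ∀ x, ι (c x) = f0 (d1 x) := fun x =>
      congrArg Subtype.val ((LinearEquiv.ofInjective ι hι).apply_symm_apply ⟨f0 (d1 x), hmem x⟩)
    obtain ⟨h, hh⟩ := (H S1 a).1 ha c (by
      ext x
      apply hι
      simp [hc, e2.apply_apply_eq_zero])
    replace hh : ∀ x, h (d1 x) = a • c x := LinearMap.congr_fun hh
    obtain ⟨k, hk⟩ := lift_exact ι π hex' (LinearMap.id - f0 ∘ₗ g) (fun x => by
      simp [hf0, hg])
    refine ⟨a • k + h ∘ₗ g, fun s => ?_⟩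
    obtain ⟨y, hy⟩ := (e1 (g (ι s))).1 (by rw [hg, hex'.apply_apply_eq_zero])
    have h3 : k (ι s) + c y = s := by
      apply hι
      rw [map_add, hk, hc, hy]
      simp
    simp only [LinearMap.add_apply, LinearMap.smul_apply, LinearMap.comp_apply]
    rw [← hy, hh, ← smul_add, h3]
  obtain ⟨h, hh⟩ := key
  obtain ⟨P0, P1, P2, _, _, _, _, _, _, d2, d1, p, hP, hp, e1, e2, H⟩ := exists_res (R := R) S1
  rw [H]
  intro c hc
  replace hc : ∀ x, c (d2 x) = 0 := LinearMap.congr_fun hc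
  obtain ⟨h', hh'⟩ := Module.projective_lifting_property p h hp
  replace hh' : ∀ x, p (h' x) = h x := LinearMap.congr_fun hh'
  obtain ⟨t, ht⟩ := lift_exact d1 p e1 (a • LinearMap.id - h' ∘ₗ ι ∘ₗ p) (fun x => by
    simp [hh', hh])
  refine ⟨c ∘ₗ t, ?_⟩
  ext x
  obtain ⟨z, hz⟩ := (e2 (t (d1 x) - a • x)).1 (by
    rw [map_sub, ht]
    simp [e1.apply_apply_eq_zero])
  have h4 := hc z
  rw [hz, map_sub, sub_eq_zero, map_smul] at h4
  exact h4
end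

section
/- Let R be a commutative Noetherian local ring and M a finitely generated R-module. Then the stable annihilator of M is contained in the stable annihilator of the R-dual M* = Hom_R(M,R). In particular, if M is reflexive then the stable annihilators of M and M* are equal. -/
open CategoryTheory Opposite IsLocalRing

universe u

variable (R : Type u) [CommRing R]

theorem smulRight_mem_stab {R : Type u} [CommRing R] {M N : Type u} [AddCommGroup M] [Module R M]
    [AddCommGroup N] [Module R N] (f : M →ₗ[R] R) (n : N) :
    f.smulRight n ∈ stablyTrivial R M N :=
  Submodule.subset_span ⟨R, inferInstance, inferInstance, inferInstance, f,
    LinearMap.toSpanSingleton R N n, by ext; simp⟩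

theorem stab_le_span {R : Type u} [CommRing R] {M N : Type u} [AddCommGroup M] [Module R M]
    [AddCommGroup N] [Module R N] [Module.Finite R M] :
    stablyTrivial R M N ≤
      Submodule.span R {f : M →ₗ[R] N | ∃ (g : M →ₗ[R] R) (n : N), f = g.smulRight n} := by
  classical
  refine Submodule.span_le.2 ?_
  rintro f ⟨F, _, _, hF, g, h, rfl⟩
  let b := Module.Free.chooseBasis R F
  obtain ⟨S, hS⟩ := (Module.Finite.fg_top : (⊤ : Submodule R M).FG)
  let s := S.biUnion fun m => (b.repr (g m)).support
  have key : h ∘ₗ g = ∑ i ∈ s, ((b.coord i) ∘ₗ g).smulRight (h (b i)) := by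
    refine LinearMap.ext_on hS ?_
    intro m hm
    have h1 : g m = ∑ i ∈ s, b.repr (g m) i • b i := by
      conv_lhs => rw [← b.linearCombination_repr (g m)]
      rw [Finsupp.linearCombination_apply]
      refine Finsupp.sum_of_support_subset _ ?_ _ (by simp)
      exact Finset.subset_biUnion_of_mem (fun m => (b.repr (g m)).support) hm
    have h2 := congrArg h h1
    simpa [LinearMap.sum_apply] using h2
  rw [key]
  exact Submodule.sum_mem _ fun i _ => Submodule.subset_span ⟨_, _, rfl⟩

theorem stab_comp {R : Type u} [CommRing R] {M N P Q : Type u} [AddCommGroup M] [Module R M]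
    [AddCommGroup N] [Module R N] [AddCommGroup P] [Module R P] [AddCommGroup Q] [Module R Q]
    (a : N →ₗ[R] P) (c : Q →ₗ[R] M) {f : M →ₗ[R] N} (hf : f ∈ stablyTrivial R M N) :
    a ∘ₗ f ∘ₗ c ∈ stablyTrivial R Q P := by
  unfold stablyTrivial at hf
  induction hf using Submodule.span_induction with
  | mem f hf =>
    obtain ⟨F, _, _, hF, g, h, rfl⟩ := hf
    exact Submodule.subset_span ⟨F, inferInstance, inferInstance, hF, g ∘ₗ c, a ∘ₗ h, rfl⟩
  | zero => simp
  | add f g _ _ hf hg =>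
    rw [LinearMap.add_comp, LinearMap.comp_add]
    exact Submodule.add_mem _ hf hg
  | smul r f _ hf =>
    rw [LinearMap.smul_comp, LinearMap.comp_smul]
    exact Submodule.smul_mem _ r hf

theorem mem_stableAnn_iff {R : Type u} [CommRing R] {M : Type u} [AddCommGroup M] [Module R M]
    (r : R) : r ∈ stableAnn R M ↔ r • (LinearMap.id : M →ₗ[R] M) ∈ stablyTrivial R M M := by
  unfold stableAnn
  rw [Module.mem_annihilator]
  constructor
  · intro h
    have := h (Submodule.Quotient.mk LinearMap.id)
    rwa [← Submodule.Quotient.mk_smul, Submodule.Quotient.mk_eq_zero] at this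
  · intro h x
    obtain ⟨f, rfl⟩ := Submodule.Quotient.mk_surjective _ x
    rw [← Submodule.Quotient.mk_smul, Submodule.Quotient.mk_eq_zero]
    exact stab_comp f LinearMap.id h |> fun h => by
      simpa [LinearMap.comp_smul] using h

theorem stableAnn_le_dual {R : Type u} [CommRing R] (M : Type u) [AddCommGroup M] [Module R M]
    [Module.Finite R M] : stableAnn R M ≤ stableAnn R (M →ₗ[R] R) := by
  intro r hr
  rw [mem_stableAnn_iff] at hr ⊢
  let T : (M →ₗ[R] M) →ₗ[R] ((M →ₗ[R] R) →ₗ[R] (M →ₗ[R] R)) := Module.Dual.transpose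
  have hT : ∀ f ∈ stablyTrivial R M M, T f ∈ stablyTrivial R (M →ₗ[R] R) (M →ₗ[R] R) := by
    intro f hf
    have := stab_le_span hf
    refine (Submodule.span_le (p := Submodule.comap T (stablyTrivial R _ _))).2 ?_ this
    rintro _ ⟨g, n, rfl⟩
    have h2 : T (g.smulRight n) = (Module.Dual.eval R M n).smulRight g := by
      ext φ x
      simp [T, Module.Dual.transpose_apply, mul_comm]
    simp only [SetLike.mem_coe, Submodule.mem_comap, h2]
    exact smulRight_mem_stab _ _
  have h3 := hT _ hr
  have h4 : T (r • LinearMap.id) = r • LinearMap.id := by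
    ext φ x
    simp [T, Module.Dual.transpose_apply]
  rwa [h4] at h3

theorem stableAnn_le_of_equiv {R : Type u} [CommRing R] {M N : Type u} [AddCommGroup M]
    [Module R M] [AddCommGroup N] [Module R N] (e : M ≃ₗ[R] N) :
    stableAnn R N ≤ stableAnn R M := by
  intro r hr
  rw [mem_stableAnn_iff] at hr ⊢
  have := stab_comp e.symm.toLinearMap e.toLinearMap hr
  convert this using 1
  ext x
  simp

/-- The stable annihilator of `M` is contained in that of `M* = Hom_R(M, R)`,
with equality when `M` is reflexive. -/
theorem stmt1 (R : Type u) [CommRing R] [IsNoetherianRing R] [IsLocalRing R]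
    (M : Type u) [AddCommGroup M] [Module R M] [Module.Finite R M] :
    stableAnn R M ≤ stableAnn R (M →ₗ[R] R) ∧
      (Module.IsReflexive R M → stableAnn R M = stableAnn R (M →ₗ[R] R)) := by
  refine ⟨stableAnn_le_dual M, fun hM => le_antisymm (stableAnn_le_dual M) ?_⟩
  have : Module.Finite R (M →ₗ[R] R) := inferInstance
  exact (stableAnn_le_dual (M →ₗ[R] R)).trans (stableAnn_le_of_equiv (Module.evalEquiv R M))
end

section
/- Let R be a commutative Noetherian local ring, M a finitely generated R-module, and suppose there exists a short exact sequence 0 → ΩM → X → M → 0 with Ext^i_R(M, X) = 0 for all i > 0. Then Ext^i_R(M, M) ≅ Ext^i_R(ΩM, ΩM) for all i > 0. -/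
open CategoryTheory Opposite IsLocalRing

universe u

variable (R : Type u) [CommRing R]

lemma extMk_smul_aux {R : Type u} [CommRing R] {A : ModuleCat.{u} R}
    (P : ProjectiveResolution A) (Y : ModuleCat.{u} R) (k : ℕ) (r : R)
    (f : P.complex.X (k + 1) ⟶ Y) (hf : P.complex.d (k + 2) (k + 1) ≫ f = 0)
    (hf' : P.complex.d (k + 2) (k + 1) ≫ (r • f) = 0) :
    P.extMk (r • f) (k + 2) rfl hf' = r • (P.extMk f (k + 2) rfl hf : Abelian.Ext.{u} A Y (k + 1)) := by
  rw [Abelian.Ext.smul_eq_comp_mk₀, P.extMk_comp_mk₀]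
  congr 1

/-- The cocycle class map as a linear map. -/
noncomputable def extMkLin {R : Type u} [CommRing R] {A : ModuleCat.{u} R}
    (P : ProjectiveResolution A) (Y : ModuleCat.{u} R) (k : ℕ) :
    LinearMap.ker ((P.complex.linearYonedaObj R Y).sc' k (k + 1) (k + 2)).g.hom →ₗ[R]
      Abelian.Ext.{u} A Y (k + 1) where
  toFun f := P.extMk (n := k + 1) (show P.complex.X (k + 1) ⟶ Y from f.1) (k + 2) rfl f.2
  map_add' f g := (P.add_extMk _ _ _ _ _ _).symm
  map_smul' r f := extMk_smul_aux P Y k r _ f.2 _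

lemma extMkLin_surj {R : Type u} [CommRing R] {A : ModuleCat.{u} R}
    (P : ProjectiveResolution A) (Y : ModuleCat.{u} R) (k : ℕ) :
    Function.Surjective (extMkLin P Y k) := by
  intro x
  obtain ⟨f, hf, rfl⟩ := P.extMk_surjective x (k + 2) rfl
  exact ⟨⟨f, hf⟩, rfl⟩

lemma extMkLin_ker {R : Type u} [CommRing R] {A : ModuleCat.{u} R}
    (P : ProjectiveResolution A) (Y : ModuleCat.{u} R) (k : ℕ) :
    LinearMap.range ((P.complex.linearYonedaObj R Y).sc' k (k + 1) (k + 2)).moduleCatToCycles =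
      LinearMap.ker (extMkLin P Y k) := by
  ext f
  refine Iff.trans ?_ (P.extMk_eq_zero_iff (n := k + 1)
    (show P.complex.X (k + 1) ⟶ Y from f.1) (k + 2) rfl f.2 k rfl).symm
  constructor
  · rintro ⟨g, hg⟩
    exact ⟨g, congrArg Subtype.val hg⟩
  · rintro ⟨g, hg⟩
    exact ⟨g, Subtype.ext hg⟩

/-- Comparison of the two Ext's in positive degrees. -/
noncomputable def extModEquiv {R : Type u} [CommRing R] (A Y : ModuleCat.{u} R) (k : ℕ) :
    ((Ext R (ModuleCat.{u} R) (k + 1)).obj (op A)).obj Y ≃ₗ[R]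
      Abelian.Ext.{u} A Y (k + 1) :=
  let P := projectiveResolution A
  (P.isoExt (R := R) (k + 1) Y ≪≫
    ShortComplex.homologyMapIso ((P.complex.linearYonedaObj R Y).isoSc' k (k + 1) (k + 2)
      (by simp) (by simp)) ≪≫
    ShortComplex.moduleCatHomologyIso _).toLinearEquiv ≪≫ₗ
  (Submodule.quotEquivOfEq _ _ (extMkLin_ker P Y k)) ≪≫ₗ
  (extMkLin P Y k).quotKerEquivOfSurjective (extMkLin_surj P Y k)

/-- Given a short exact sequence `0 → ΩM → X → M → 0` with `Ext^i(M, X) = 0` for all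
`i > 0`, we have `Ext^i(M, M) ≅ Ext^i(ΩM, ΩM)` for all `i > 0`. -/
theorem stmt5 (R : Type u) [CommRing R] [IsNoetherianRing R] [IsLocalRing R]
    (M S X : Type u) [AddCommGroup M] [Module R M] [Module.Finite R M]
    [AddCommGroup S] [Module R S] [AddCommGroup X] [Module R X] [Module.Finite R X]
    (hS : IsSyzygy R M S)
    (ι : S →ₗ[R] X) (π : X →ₗ[R] M)
    (hι : Function.Injective ι) (hπ : Function.Surjective π)
    (hexact : LinearMap.range ι = LinearMap.ker π)
    (hvanish : ∀ i : ℕ, 0 < i → Subsingleton (ExtMod R i M X)) :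
    ∀ i : ℕ, 0 < i → Nonempty (ExtMod R i M M ≅ ExtMod R i S S) := by
  intro i hi
  obtain ⟨k, rfl⟩ : ∃ k, i = k + 1 := ⟨i - 1, by omega⟩
  obtain ⟨F, _, _, j, p, _, _, hj, hp, hjp⟩ := hS
  have hA : (ModuleCat.ofHom j ≫ ModuleCat.ofHom p) = 0 := by
    ext x
    have : j x ∈ LinearMap.ker p := hjp ▸ ⟨x, rfl⟩
    simpa using this
  have hB : (ModuleCat.ofHom ι ≫ ModuleCat.ofHom π) = 0 := by
    ext x
    have : ι x ∈ LinearMap.ker π := hexact ▸ ⟨x, rfl⟩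
    simpa using this
  have eA : (ShortComplex.mk _ _ hA).ShortExact :=
    { exact := (ShortComplex.moduleCat_exact_iff_range_eq_ker _).2 hjp
      mono_f := (ModuleCat.mono_iff_injective _).2 hj
      epi_g := (ModuleCat.epi_iff_surjective _).2 hp }
  have eB : (ShortComplex.mk _ _ hB).ShortExact :=
    { exact := (ShortComplex.moduleCat_exact_iff_range_eq_ker _).2 hexact
      mono_f := (ModuleCat.mono_iff_injective _).2 hι
      epi_g := (ModuleCat.epi_iff_surjective _).2 hπ }
  have hX (n : ℕ) (x : Abelian.Ext.{u} (ModuleCat.of R M) (ModuleCat.of R X) (n + 1)) : x = 0 :=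
    haveI := hvanish (n + 1) n.succ_pos
    (extModEquiv (ModuleCat.of R M) (ModuleCat.of R X) n).symm.injective
      (Subsingleton.elim (α := ExtMod R (n + 1) M X) _ _)
  haveI : Projective (ModuleCat.of R F) :=
    ModuleCat.projective_of_free (Module.Free.chooseBasis R F)
  have hF (n : ℕ) (x : Abelian.Ext.{u} (ModuleCat.of R F) (ModuleCat.of R S) (n + 1)) : x = 0 :=
    Abelian.Ext.eq_zero_of_projective x
  let φ : Abelian.Ext.{u} (ModuleCat.of R M) (ModuleCat.of R M) (k + 1) →ₗ[R]
      Abelian.Ext.{u} (ModuleCat.of R M) (ModuleCat.of R S) (k + 2) :=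
    Abelian.Ext.postcompOfLinear eB.extClass R (ModuleCat.of R M) rfl
  let ψ : Abelian.Ext.{u} (ModuleCat.of R S) (ModuleCat.of R S) (k + 1) →ₗ[R]
      Abelian.Ext.{u} (ModuleCat.of R M) (ModuleCat.of R S) (k + 2) :=
    Abelian.Ext.precompOfLinear eA.extClass R (ModuleCat.of R S) (by omega)
  have hφ : Function.Bijective φ := by
    refine ⟨(injective_iff_map_eq_zero φ).2 fun x hx => ?_, fun y => ?_⟩
    · obtain ⟨z, rfl⟩ := Abelian.Ext.covariant_sequence_exact₃ (ModuleCat.of R M) eB x rfl hx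
      rw [hX k z, Abelian.Ext.zero_comp]
    · exact Abelian.Ext.covariant_sequence_exact₁ (ModuleCat.of R M) eB y (hX (k + 1) _) rfl
  have hψ : Function.Bijective ψ := by
    refine ⟨(injective_iff_map_eq_zero ψ).2 fun x hx => ?_, fun y => ?_⟩
    · obtain ⟨z, rfl⟩ := Abelian.Ext.contravariant_sequence_exact₁ eA (ModuleCat.of R S) x
        (by omega) hx
      rw [hF k z, Abelian.Ext.comp_zero]
    · exact Abelian.Ext.contravariant_sequence_exact₃ eA (ModuleCat.of R S) y (hF (k + 1) _)
        (by omega)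
  exact ⟨(extModEquiv (ModuleCat.of R M) (ModuleCat.of R M) k ≪≫ₗ LinearEquiv.ofBijective φ hφ ≪≫ₗ
    (LinearEquiv.ofBijective ψ hψ).symm ≪≫ₗ
    (extModEquiv (ModuleCat.of R S) (ModuleCat.of R S) k).symm).toModuleIso⟩
end

section
/- Let R be a commutative Noetherian local ring and M a finitely generated R-module. Then the Auslander–Reiten annihilator of M ⊕ ΩM equals the stable annihilator of M ⊕ ΩM; that is, ⋂_{i>0} ann_R Ext^i_R(M ⊕ ΩM, (M ⊕ ΩM) ⊕ R) equals ann_R Ext^1_R(M ⊕ ΩM, Ω(M ⊕ ΩM)). -/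
open CategoryTheory Opposite IsLocalRing

universe u

variable (R : Type u) [CommRing R]

/-- The opposite of a linear category is linear. -/
@[reducible] noncomputable def linearOpposite (A : Type*) [CommRing A] (D : Type*) [Category* D]
    [Preadditive D] [Linear A D] : Linear A Dᵒᵖ where
  homModule X Y :=
    { smul := fun a f => (a • f.unop).op
      one_smul := fun f => Quiver.Hom.unop_inj (one_smul A f.unop)
      mul_smul := fun a b f => Quiver.Hom.unop_inj (mul_smul a b f.unop)
      smul_zero := fun a => Quiver.Hom.unop_inj (smul_zero a)
      smul_add := fun a f g => Quiver.Hom.unop_inj (smul_add a f.unop g.unop)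
      add_smul := fun a b f => Quiver.Hom.unop_inj (add_smul a b f.unop)
      zero_smul := fun f => Quiver.Hom.unop_inj (zero_smul A f.unop) }
  smul_comp X Y Z a f g := Quiver.Hom.unop_inj (Linear.comp_smul _ _ _ g.unop a f.unop)
  comp_smul X Y Z f a g := Quiver.Hom.unop_inj (Linear.smul_comp _ _ _ a g.unop f.unop)

theorem leftDerived_map_smul_id (A : Type*) [CommRing A] {C D : Type*} [Category* C] [Abelian C]
    [Linear A C] [EnoughProjectives C] [Category* D] [Abelian D] [Linear A D]
    (F : C ⥤ D) [F.Additive] [F.Linear A] (n : ℕ) (X : C) (a : A) :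
    (F.leftDerived n).map (a • 𝟙 X) = a • 𝟙 _ := by
  let P := projectiveResolution X
  rw [F.leftDerived_map_eq n (a • 𝟙 X) (P := P) (Q := P) (a • 𝟙 P.complex) (by
    ext
    simp only [HomologicalComplex.comp_f, HomologicalComplex.smul_f_apply,
      HomologicalComplex.id_f, ChainComplex.single₀_map_f_zero]
    exact (Linear.smul_comp _ _ _ a _ _).trans ((congrArg (a • ·) ((Category.id_comp _).trans
      (Category.comp_id _).symm)).trans (Linear.comp_smul _ _ _ _ a (𝟙 X)).symm))]
  have : (F.mapHomologicalComplex (ComplexShape.down ℕ) ⋙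
      HomologicalComplex.homologyFunctor _ _ n).map (a • 𝟙 P.complex) = a • 𝟙 _ := by
    rw [Functor.comp_map, Functor.map_smul, CategoryTheory.Functor.map_id]
    have := ShortComplex.homologyMap_smul
      (𝟙 (((F.mapHomologicalComplex (ComplexShape.down ℕ)).obj P.complex).sc n)) a
    rw [ShortComplex.homologyMap_id] at this
    exact this
  rw [this]
  simp

theorem ext_map_smul_id (R : Type u) [CommRing R] (n : ℕ) (X Y : ModuleCat.{u} R) (a : R) :
    ((Ext R (ModuleCat.{u} R) n).map (a • 𝟙 X).op).app Y = a • 𝟙 _ := by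
  letI := linearOpposite R (ModuleCat.{u} R)
  haveI : Functor.Linear R (((linearYoneda R (ModuleCat.{u} R)).obj Y).rightOp) :=
    { map_smul := by
        intro U V f r
        apply Quiver.Hom.unop_inj
        ext g
        exact Linear.smul_comp U V Y r f g }
  exact congrArg Quiver.Hom.unop (leftDerived_map_smul_id R
    (((linearYoneda R (ModuleCat.{u} R)).obj Y).rightOp) n X a)

theorem mem_extAnn_of_factors (R : Type u) [CommRing R] (N L F : Type u)
    [AddCommGroup N] [Module R N] [AddCommGroup L] [Module R L] [AddCommGroup F] [Module R F]
    [Module.Free R F] (a : R) (g : N →ₗ[R] F) (h : F →ₗ[R] N)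
    (hgh : ∀ x, h (g x) = a • x) (n : ℕ) : a ∈ extAnn R (n + 1) N L := by
  have h0 := ext_map_smul_id R (n+1) (ModuleCat.of R N) (ModuleCat.of R L) a
  have e : a • 𝟙 (ModuleCat.of R N) = ModuleCat.ofHom g ≫ ModuleCat.ofHom h := by
    ext x
    exact (hgh x).symm
  haveI : Projective (ModuleCat.of R F) :=
    (IsProjective.iff_projective (R := R) (P := F)).1 inferInstance
  have hz := isZero_Ext_succ_of_projective (R := R) (ModuleCat.of R F) (ModuleCat.of R L) n
  rw [e, op_comp, Functor.map_comp, NatTrans.comp_app, hz.eq_of_src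
    (((Ext R (ModuleCat.{u} R) (n+1)).map (ModuleCat.ofHom g).op).app (ModuleCat.of R L)) 0,
    Limits.comp_zero] at h0
  refine Module.mem_annihilator.2 fun x => ?_
  exact (congrArg (fun φ => φ.hom x) h0).symm

theorem extAnn_le_of_retract (R : Type u) [CommRing R] (N L M S : Type u)
    [AddCommGroup N] [Module R N] [AddCommGroup L] [Module R L]
    [AddCommGroup M] [Module R M] [AddCommGroup S] [Module R S]
    (i : M →ₗ[R] N) (p : N →ₗ[R] M) (hip : p ∘ₗ i = LinearMap.id)
    (j : S →ₗ[R] L) (q : L →ₗ[R] S) (hjq : q ∘ₗ j = LinearMap.id) (n : ℕ) :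
    extAnn R n N L ≤ extAnn R n M S := by
  intro a ha
  let E := Ext R (ModuleCat.{u} R) n
  let u : (E.obj (op (ModuleCat.of R M))).obj (ModuleCat.of R S) ⟶
      (E.obj (op (ModuleCat.of R N))).obj (ModuleCat.of R L) :=
    (E.map (ModuleCat.ofHom p).op).app _ ≫ (E.obj _).map (ModuleCat.ofHom j)
  let v : (E.obj (op (ModuleCat.of R N))).obj (ModuleCat.of R L) ⟶
      (E.obj (op (ModuleCat.of R M))).obj (ModuleCat.of R S) :=
    (E.obj _).map (ModuleCat.ofHom q) ≫ (E.map (ModuleCat.ofHom i).op).app _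
  have e1 : (ModuleCat.ofHom p).op ≫ (ModuleCat.ofHom i).op = 𝟙 (op (ModuleCat.of R M)) := by
    rw [← op_comp, ← ModuleCat.ofHom_comp, hip]; rfl
  have e2 : ModuleCat.ofHom j ≫ ModuleCat.ofHom q = 𝟙 (ModuleCat.of R S) := by
    rw [← ModuleCat.ofHom_comp, hjq]; rfl
  have huv : u ≫ v = 𝟙 _ := by
    simp only [u, v, Category.assoc]
    rw [← Functor.map_comp_assoc, e2, CategoryTheory.Functor.map_id, Category.id_comp, ← NatTrans.comp_app,
      ← Functor.map_comp, e1, CategoryTheory.Functor.map_id]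
    rfl
  refine Module.mem_annihilator.2 fun x => ?_
  have hx : v.hom (u.hom x) = x := congrArg (fun φ => φ.hom x) huv
  have := Module.mem_annihilator.1 ha (u.hom x)
  have h2 : v.hom (a • u.hom x) = 0 := by
    erw [this]; exact map_zero _
  rw [map_smul, hx] at h2
  exact h2

theorem boundary_of_homology_ann (R : Type u) [CommRing R] (K : ShortComplex (ModuleCat.{u} R))
    (a : R) (ha : ∀ x : K.homology, a • x = 0) (z : K.X₂) (hz : K.g z = 0) :
    ∃ y : K.X₁, K.f y = a • z := by
  let c : LinearMap.ker K.g.hom := ⟨z, hz⟩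
  have h1 : ∀ x : K.moduleCatLeftHomologyData.H, a • x = 0 := by
    intro x
    have := congrArg K.moduleCatHomologyIso.hom.hom (ha (K.moduleCatHomologyIso.inv.hom x))
    rw [map_smul, map_zero] at this
    rwa [show K.moduleCatHomologyIso.hom.hom (K.moduleCatHomologyIso.inv.hom x) = x from
      congrArg (fun φ => φ.hom x) K.moduleCatHomologyIso.inv_hom_id] at this
  have h2 := h1 (Submodule.Quotient.mk c)
  have h3 : (Submodule.Quotient.mk (a • c) : _ ⧸ LinearMap.range K.moduleCatToCycles) = 0 := h2
  rw [Submodule.Quotient.mk_eq_zero] at h3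
  obtain ⟨y, hy⟩ := h3
  exact ⟨y, congrArg Subtype.val hy⟩

theorem factors_of_mem_extAnn (R : Type u) [CommRing R] (M S F : Type u)
    [AddCommGroup M] [Module R M] [AddCommGroup S] [Module R S] [AddCommGroup F] [Module R F]
    (ι : S →ₗ[R] F) (π : F →ₗ[R] M) (hι : Function.Injective ι) (hπ : Function.Surjective π)
    (hex : LinearMap.range ι = LinearMap.ker π) (a : R) (ha : a ∈ extAnn R 1 M S) :
    ∃ g : M →ₗ[R] F, ∀ x, π (g x) = a • x := by
  let P := projectiveResolution (ModuleCat.of R M)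
  let K := P.complex.linearYonedaObj R (ModuleCat.of R S)
  have hK : ∀ x : K.homology 1, a • x = 0 := by
    intro x
    let e := P.isoExt (R := R) 1 (ModuleCat.of R S)
    have := congrArg e.hom.hom (Module.mem_annihilator.1 ha (e.inv.hom x))
    erw [map_smul, map_zero] at this
    rwa [show e.hom.hom (e.inv.hom x) = x from
      congrArg (fun φ => φ.hom x) e.inv_hom_id] at this
  have hK' : ∀ x : (K.sc' 0 1 2).homology, a • x = 0 := by
    intro x
    let e : (K.sc 1).homology ≅ (K.sc' 0 1 2).homology :=
      ShortComplex.homologyMapIso (K.isoSc' 0 1 2 (by simp) (by simp))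
    have := congrArg e.hom.hom (hK (e.inv.hom x))
    erw [map_smul, map_zero] at this
    rwa [show e.hom.hom (e.inv.hom x) = x from
      congrArg (fun φ => φ.hom x) e.inv_hom_id] at this
  -- the augmentation
  let ε : P.complex.X 0 ⟶ ModuleCat.of R M := P.π.f 0
  let ι' : ModuleCat.of R S ⟶ ModuleCat.of R F := ModuleCat.ofHom ι
  let π' : ModuleCat.of R F ⟶ ModuleCat.of R M := ModuleCat.ofHom π
  haveI : Epi π' := (ModuleCat.epi_iff_surjective _).2 hπ
  haveI : Mono ι' := (ModuleCat.mono_iff_injective _).2 hι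
  have hεd : P.complex.d 1 0 ≫ ε = 0 := P.complex_d_comp_π_f_zero
  have hιπ : ι' ≫ π' = 0 := by
    ext x
    have : ι x ∈ LinearMap.ker π := hex ▸ LinearMap.mem_range_self ι x
    exact this
  have hSE : (ShortComplex.mk ι' π' hιπ).Exact :=
    ShortComplex.Exact.moduleCat_of_range_eq_ker _ _ hex
  let α₀ : P.complex.X 0 ⟶ ModuleCat.of R F := Projective.factorThru ε π'
  have hα₀ : α₀ ≫ π' = ε := Projective.factorThru_comp ε π'
  obtain ⟨α₁, hα₁⟩ : ∃ α₁ : P.complex.X 1 ⟶ ModuleCat.of R S, α₁ ≫ ι' = P.complex.d 1 0 ≫ α₀ :=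
    ⟨hSE.liftFromProjective (P.complex.d 1 0 ≫ α₀) (by
      change (P.complex.d 1 0 ≫ α₀) ≫ π' = 0
      rw [Category.assoc, hα₀, hεd]), hSE.liftFromProjective_comp _ _⟩
  have hd : P.complex.d 2 1 ≫ α₁ = 0 := by
    rw [← cancel_mono ι', Category.assoc, hα₁, ← Category.assoc, HomologicalComplex.d_comp_d,
      Limits.zero_comp, Limits.zero_comp]
  obtain ⟨β, hβ⟩ : ∃ β : P.complex.X 0 ⟶ ModuleCat.of R S, P.complex.d 1 0 ≫ β = a • α₁ :=
    boundary_of_homology_ann R (K.sc' 0 1 2) a hK' α₁ hd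
  have hz : P.complex.d 1 0 ≫ (a • α₀ - β ≫ ι') = 0 := by
    rw [Preadditive.comp_sub, Linear.comp_smul, ← hα₁, ← Category.assoc, hβ, Linear.smul_comp,
      sub_self]
  obtain ⟨g, hg⟩ : ∃ g : ModuleCat.of R M ⟶ ModuleCat.of R F, ε ≫ g = a • α₀ - β ≫ ι' :=
    ⟨P.isColimitCokernelCofork.desc (Limits.CokernelCofork.ofπ _ hz),
      P.isColimitCokernelCofork.fac (Limits.CokernelCofork.ofπ _ hz)
        Limits.WalkingParallelPair.one⟩
  haveI : Epi ε := inferInstanceAs (Epi (P.π.f 0))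
  have hfin : g ≫ π' = a • 𝟙 _ := by
    rw [← cancel_epi ε, ← Category.assoc, hg, Preadditive.sub_comp, Category.assoc, hιπ,
      Linear.smul_comp, hα₀]
    simp
  exact ⟨g.hom, fun x => congrArg (fun φ => φ.hom x) hfin⟩

/-- If `a` factors through `F` on `M`, it factors through `F` on the kernel `S` of `F → M`. -/
theorem factors_syzygy (R : Type u) [CommRing R] (M S F : Type u)
    [AddCommGroup M] [Module R M] [AddCommGroup S] [Module R S] [AddCommGroup F] [Module R F]
    (ι : S →ₗ[R] F) (π : F →ₗ[R] M) (hι : Function.Injective ι)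
    (hex : LinearMap.range ι = LinearMap.ker π) (a : R) (g : M →ₗ[R] F)
    (hg : ∀ x, π (g x) = a • x) :
    ∃ h : F →ₗ[R] S, ∀ x, h (ι x) = a • x := by
  let e := LinearEquiv.ofInjective ι hι
  let k : F →ₗ[R] LinearMap.range ι :=
    LinearMap.codRestrict _ (a • LinearMap.id - g ∘ₗ π) (by
      intro x
      rw [hex, LinearMap.mem_ker]
      simp [hg])
  refine ⟨e.symm.toLinearMap ∘ₗ k, fun x => ?_⟩
  have hx : π (ι x) = 0 := by
    have : ι x ∈ LinearMap.ker π := hex ▸ LinearMap.mem_range_self ι x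
    exact this
  change e.symm (k (ι x)) = a • x
  rw [LinearEquiv.symm_apply_eq]
  apply Subtype.ext
  change a • ι x - g (π (ι x)) = ι (a • x)
  simp [hx]

/-- The Auslander–Reiten annihilator of `M ⊕ ΩM` equals its stable annihilator. -/
theorem stmt7 (R : Type u) [CommRing R] [IsNoetherianRing R] [IsLocalRing R]
    (M S T : Type u) [AddCommGroup M] [Module R M] [Module.Finite R M]
    [AddCommGroup S] [Module R S] [AddCommGroup T] [Module R T]
    (hS : IsSyzygy R M S) (hT : IsSyzygy R (M × S) T) :
    ARann R (M × S) = extAnn R 1 (M × S) T := by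
  obtain ⟨F, _, _, ι, π, hF, _, hι, hπ, hex⟩ := hS
  obtain ⟨G, _, _, κ, ρ, hG, _, hκ, hρ, hex'⟩ := hT
  apply le_antisymm
  · intro a ha
    have ha1 : a ∈ extAnn R 1 (M × S) ((M × S) × R) := by
      have := (Submodule.mem_iInf _).1 ha 0
      exact this
    have ha2 : a ∈ extAnn R 1 M S :=
      extAnn_le_of_retract R (M × S) ((M × S) × R) M S
        (LinearMap.inl R M S) (LinearMap.fst R M S) (by ext; rfl)
        (LinearMap.inl R (M × S) R ∘ₗ LinearMap.inr R M S)
        (LinearMap.snd R M S ∘ₗ LinearMap.fst R (M × S) R) (by ext; rfl) 1 ha1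
    obtain ⟨g, hg⟩ := factors_of_mem_extAnn R M S F ι π hι hπ hex a ha2
    obtain ⟨h, hh⟩ := factors_syzygy R M S F ι π hι hex a g hg
    exact mem_extAnn_of_factors R (M × S) T (F × F) a (g.prodMap ι) (π.prodMap h)
      (fun x => Prod.ext (hg x.1) (hh x.2)) 0
  · intro a ha
    obtain ⟨g, hg⟩ := factors_of_mem_extAnn R (M × S) T G κ ρ hκ hρ hex' a ha
    exact (Submodule.mem_iInf _).2 fun i =>
      mem_extAnn_of_factors R (M × S) ((M × S) × R) G a g ρ hg i
end

section
/- Let R be a commutative Noetherian local ring, M a finitely generated R-module, and x ∈ R an element that is a nonzerodivisor on M and lies in the stable annihilator of M (i.e., x annihilates Ext^1_R(M, ΩM)). Then Ω_R(M/xM) ≅ M ⊕ ΩM up to free direct summands. -/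
open CategoryTheory Opposite IsLocalRing

universe u

variable (R : Type u) [CommRing R]

lemma sc_smul_boundary {R : Type u} [CommRing R] (T : ShortComplex (ModuleCat.{u} R)) (x : R)
    (h : ∀ a : T.homology, x • a = 0) (z : T.X₂) (hz : T.g z = 0) :
    ∃ y : T.X₁, T.f y = x • z := by
  let c : LinearMap.ker T.g.hom := ⟨z, hz⟩
  have h1 : x • (Submodule.Quotient.mk c : LinearMap.ker T.g.hom ⧸ LinearMap.range T.moduleCatToCycles) = 0 := by
    have e := T.moduleCatHomologyIso.toLinearEquiv
    obtain ⟨a, ha⟩ := e.surjective (Submodule.Quotient.mk c)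
    have := h a
    have h2 := congrArg e this
    rw [map_smul, ha, map_zero] at h2
    exact h2
  rw [← Submodule.Quotient.mk_smul, Submodule.Quotient.mk_eq_zero] at h1
  obtain ⟨y, hy⟩ := h1
  exact ⟨y, congrArg Subtype.val hy⟩

lemma ext_boundary {R : Type u} [CommRing R] (M S : Type u) [AddCommGroup M] [Module R M]
    [AddCommGroup S] [Module R S] (x : R) (hx : x ∈ extAnn R 1 M S)
    (P : ProjectiveResolution (ModuleCat.of R M))
    (a : P.complex.X 1 ⟶ ModuleCat.of R S) (ha : P.complex.d 2 1 ≫ a = 0) :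
    ∃ c : P.complex.X 0 ⟶ ModuleCat.of R S, P.complex.d 1 0 ≫ c = x • a := by
  let K := P.complex.linearYonedaObj R (ModuleCat.of R S)
  have hx' := Module.mem_annihilator.1 hx
  let e := (P.isoExt (R := R) 1 (ModuleCat.of R S) ≪≫
    ShortComplex.homologyMapIso (K.isoSc' 0 1 2 (by simp) (by simp))).toLinearEquiv
  have h : ∀ b : (K.sc' 0 1 2).homology, x • b = 0 := by
    intro b
    obtain ⟨b', rfl⟩ := e.surjective b
    rw [← map_smul]
    have : x • b' = 0 := hx' b'
    rw [this, map_zero]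
  exact sc_smul_boundary _ x h a ha

lemma exists_lift {R : Type u} [CommRing R] (M S F : Type u) [AddCommGroup M] [Module R M]
    [AddCommGroup S] [Module R S] [AddCommGroup F] [Module R F] (x : R)
    (hx : x ∈ extAnn R 1 M S) (ι : S →ₗ[R] F) (π : F →ₗ[R] M)
    (hι : Function.Injective ι) (hπ : Function.Surjective π)
    (he : LinearMap.range ι = LinearMap.ker π) :
    ∃ g : M →ₗ[R] F, ∀ m, π (g m) = x • m := by
  let P := projectiveResolution (ModuleCat.of R M)
  let i := ModuleCat.ofHom ι
  let p := ModuleCat.ofHom π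
  have hip : i ≫ p = 0 := by
    ext s
    have : ι s ∈ LinearMap.ker π := he ▸ LinearMap.mem_range_self ι s
    exact this
  have hex : (ShortComplex.mk i p hip).Exact := by
    rw [ShortComplex.moduleCat_exact_iff_range_eq_ker]
    exact he
  have : Epi p := (ModuleCat.epi_iff_surjective _).2 hπ
  have : Mono i := (ModuleCat.mono_iff_injective _).2 hι
  let ε : P.complex.X 0 ⟶ ModuleCat.of R M := P.π.f 0
  have : Epi ε := inferInstanceAs (Epi (P.π.f 0))
  have hdε : P.complex.d 1 0 ≫ ε = 0 := P.complex_d_comp_π_f_zero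
  have hexε : (ShortComplex.mk _ ε hdε).Exact := P.exact₀
  let a0 : P.complex.X 0 ⟶ ModuleCat.of R F := Projective.factorThru ε p
  have ha0 : a0 ≫ p = ε := Projective.factorThru_comp ε p
  have h1 : (P.complex.d 1 0 ≫ a0) ≫ p = 0 := by rw [Category.assoc, ha0, hdε]
  let a1 : P.complex.X 1 ⟶ ModuleCat.of R S := hex.lift (P.complex.d 1 0 ≫ a0) h1
  have ha1 : a1 ≫ i = P.complex.d 1 0 ≫ a0 := hex.lift_f _ _
  obtain ⟨c, hc⟩ := ext_boundary M S x hx P a1 (by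
    rw [← cancel_mono i, Category.assoc, ha1, ← Category.assoc]; simp)
  have h2 : P.complex.d 1 0 ≫ (x • a0 - c ≫ i) = 0 := by
    rw [Preadditive.comp_sub, ← Category.assoc, hc, Linear.comp_smul, Linear.smul_comp, ha1,
      sub_self]
  let g : ModuleCat.of R M ⟶ ModuleCat.of R F := hexε.desc (x • a0 - c ≫ i) h2
  have hg : ε ≫ g = x • a0 - c ≫ i := hexε.g_desc _ _
  have h3 : g ≫ p = x • 𝟙 _ := by
    rw [← cancel_epi ε, ← Category.assoc, hg, Preadditive.sub_comp, Category.assoc, hip,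
      Linear.smul_comp, ha0]
    simp
  refine ⟨g.hom, fun m => ?_⟩
  have := congrArg (fun f => f.hom m) h3
  exact this

/-- One half of Schanuel: the pullback. -/
lemma schanuel_half {R : Type u} [CommRing R] {N F G K L : Type u} [AddCommGroup N] [Module R N]
    [AddCommGroup F] [Module R F] [AddCommGroup G] [Module R G]
    [AddCommGroup K] [Module R K] [AddCommGroup L] [Module R L]
    [Module.Projective R F] [Module.Projective R G]
    (i : K →ₗ[R] F) (p : F →ₗ[R] N) (j : L →ₗ[R] G) (q : G →ₗ[R] N)
    (hi : Function.Injective i) (hp : Function.Surjective p)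
    (hip : LinearMap.range i = LinearMap.ker p)
    (hj : Function.Injective j) (hq : Function.Surjective q)
    (hjq : LinearMap.range j = LinearMap.ker q) :
    Nonempty ((K × G) ≃ₗ[R] (L × F)) := by
  have half : ∀ {F G K : Type u} [AddCommGroup F] [Module R F] [AddCommGroup G] [Module R G]
    [AddCommGroup K] [Module R K] [Module.Projective R G]
    (i : K →ₗ[R] F) (p : F →ₗ[R] N) (q : G →ₗ[R] N)
    (_ : Function.Injective i) (_ : Function.Surjective p)
    (_ : LinearMap.range i = LinearMap.ker p),
    Nonempty ((K × G) ≃ₗ[R] (LinearMap.eqLocus (p ∘ₗ LinearMap.fst R F G)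
      (q ∘ₗ LinearMap.snd R F G))) := by
    intro F G K _ _ _ _ _ _ _ i p q hi hp hip
    obtain ⟨s, hs⟩ := Module.projective_lifting_property p q hp
    have hs' : ∀ y, p (s y) = q y := fun y => LinearMap.congr_fun hs y
    have hpi : ∀ k, p (i k) = 0 := fun k => by
      have : i k ∈ LinearMap.ker p := hip ▸ LinearMap.mem_range_self i k
      exact this
    let φ : (K × G) →ₗ[R] (F × G) :=
      (i ∘ₗ LinearMap.fst R K G + s ∘ₗ LinearMap.snd R K G).prod (LinearMap.snd R K G)
    refine ⟨LinearEquiv.ofBijective (φ.codRestrict _ ?_) ⟨?_, ?_⟩⟩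
    · rintro ⟨k, y⟩
      simp [φ, LinearMap.mem_eqLocus, hpi, hs']
    · rw [LinearMap.injective_codRestrict_iff]
      rintro ⟨k, y⟩ ⟨k', y'⟩ h
      simp [φ] at h
      obtain ⟨h1, rfl⟩ := h
      simp at h1
      rw [hi h1]
    · rintro ⟨⟨f, y⟩, h⟩
      have h : p f = q y := h
      have : f - s y ∈ LinearMap.range i := by
        rw [hip, LinearMap.mem_ker, map_sub, hs', h, sub_self]
      obtain ⟨k, hk⟩ := this
      refine ⟨(k, y), Subtype.ext ?_⟩
      simp [φ, hk]
  obtain ⟨e1⟩ := half i p q hi hp hip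
  obtain ⟨e2⟩ := half j q p hj hq hjq
  let e3 : (LinearMap.eqLocus (p ∘ₗ LinearMap.fst R F G) (q ∘ₗ LinearMap.snd R F G)) ≃ₗ[R]
     (LinearMap.eqLocus (q ∘ₗ LinearMap.fst R G F) (p ∘ₗ LinearMap.snd R G F)) :=
    (LinearEquiv.prodComm R F G).ofSubmodules _ _ (by
      ext ⟨a, b⟩
      simp only [Submodule.mem_map_equiv, LinearMap.mem_eqLocus]
      exact eq_comm)
  exact ⟨e1.trans (e3.trans e2.symm)⟩

open scoped Pointwise in
lemma quot_map {R : Type u} [CommRing R] (M : Type u) [AddCommGroup M] [Module R M] (x : R) :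
    ∃ Q : M →ₗ[R] QuotSMulTop x M, Function.Surjective Q ∧
      ∀ m, Q m = 0 ↔ ∃ n, x • n = m := by
  refine ⟨Submodule.mkQ (x • (⊤ : Submodule R M)), Submodule.mkQ_surjective _, fun m => ?_⟩
  rw [Submodule.mkQ_apply, Submodule.Quotient.mk_eq_zero, Submodule.mem_smul_pointwise_iff_exists]
  simp

/-- If `x` is a nonzerodivisor on `M` lying in the stable annihilator of `M`, then
`Ω(M/xM) ≅ M ⊕ ΩM` up to free direct summands. -/
theorem stmt9 (R : Type u) [CommRing R] [IsNoetherianRing R] [IsLocalRing R]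
    (M S T : Type u) [AddCommGroup M] [Module R M] [Module.Finite R M]
    [AddCommGroup S] [Module R S] [AddCommGroup T] [Module R T]
    (hS : IsSyzygy R M S) (x : R) (hreg : IsSMulRegular M x)
    (hx : x ∈ extAnn R 1 M S)
    (hT : IsSyzygy R (QuotSMulTop x M) T) :
    ∃ (F₁ F₂ : Type u) (_ : AddCommGroup F₁) (_ : Module R F₁)
      (_ : AddCommGroup F₂) (_ : Module R F₂),
      Module.Free R F₁ ∧ Module.Finite R F₁ ∧ Module.Free R F₂ ∧ Module.Finite R F₂ ∧
        Nonempty ((T × F₁) ≃ₗ[R] ((M × S) × F₂)) := by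
  obtain ⟨F, _, _, ι, π, hF, hFf, hι, hπ, he⟩ := hS
  obtain ⟨G, _, _, j, q, hG, hGf, hj, hq, hjq⟩ := hT
  obtain ⟨g, hg⟩ := exists_lift M S F x hx ι π hι hπ he
  have hπι : ∀ s, π (ι s) = 0 := fun s => by
    have : ι s ∈ LinearMap.ker π := he ▸ LinearMap.mem_range_self ι s
    exact this
  obtain ⟨Q, hQ, hmk⟩ := quot_map M x
  obtain ⟨e⟩ := schanuel_half (N := QuotSMulTop x M) j q (g.coprod ι)
    (Q ∘ₗ π) hj hq hjq
    (by
      rw [← LinearMap.ker_eq_bot, LinearMap.ker_eq_bot']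
      rintro ⟨m, s⟩ h
      rw [LinearMap.coprod_apply] at h
      have h1 := congrArg π h
      rw [map_add, hg, hπι, add_zero, map_zero] at h1
      have hm : m = 0 := hreg (by simpa using h1)
      subst hm
      rw [map_zero, zero_add] at h
      have : s = 0 := hι (by simpa using h)
      rw [this]; rfl)
    (hQ.comp hπ)
    (by
      ext f
      rw [LinearMap.mem_ker, LinearMap.comp_apply, hmk]
      constructor
      · rintro ⟨⟨m, s⟩, rfl⟩
        exact ⟨m, by rw [LinearMap.coprod_apply, map_add, hg, hπι, add_zero]⟩
      · rintro ⟨m, hm⟩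
        have : f - g m ∈ LinearMap.range ι := by
          rw [he, LinearMap.mem_ker, map_sub, hg, hm, sub_self]
        obtain ⟨s, hs⟩ := this
        exact ⟨(m, s), by rw [LinearMap.coprod_apply, hs]; abel⟩)
  exact ⟨F, G, _, _, _, _, hF, hFf, hG, hGf, ⟨e⟩⟩
end

section
/- Let R be a commutative Noetherian local ring and M a finitely generated R-module with a periodic projective resolution (i.e., Ω^n M ≅ M up to free summands for some n ≥ 1). Then the Auslander–Reiten annihilator of M equals the stable annihilator of M: ⋂_{i>0} ann_R Ext^i_R(M, M ⊕ R) = ann_R Ext^1_R(M, ΩM). -/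
open CategoryTheory Opposite IsLocalRing

universe u

variable (R : Type u) [CommRing R]

namespace Stmt10

/-- Elementwise description of the annihilator of the homology of a short complex of modules. -/
lemma mem_ann_homology {R : Type u} [CommRing R] (S : ShortComplex (ModuleCat.{u} R)) (a : R) :
    a ∈ Module.annihilator R S.homology ↔
      ∀ x : S.X₂, S.g x = 0 → ∃ y : S.X₁, S.f y = a • x := by
  rw [S.moduleCatHomologyIso.toLinearEquiv.annihilator_eq]
  change a ∈ Module.annihilator R
    (LinearMap.ker S.g.hom ⧸ LinearMap.range S.moduleCatToCycles) ↔ _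
  rw [Module.mem_annihilator]
  constructor
  · intro h x hx
    have := h (Submodule.Quotient.mk (⟨x, hx⟩ : LinearMap.ker S.g.hom))
    rw [← Submodule.Quotient.mk_smul] at this
    obtain ⟨y, hy⟩ := (Submodule.Quotient.mk_eq_zero _).1 this
    exact ⟨y, congrArg Subtype.val hy⟩
  · intro h q
    obtain ⟨⟨x, hx⟩, rfl⟩ := Submodule.Quotient.mk_surjective _ q
    obtain ⟨y, hy⟩ := h x hx
    rw [← Submodule.Quotient.mk_smul]
    exact (Submodule.Quotient.mk_eq_zero _).2 ⟨y, Subtype.ext hy⟩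

lemma mem_extAnn_iff_res {R : Type u} [CommRing R] (i : ℕ) (M N : Type u)
    [AddCommGroup M] [Module R M] [AddCommGroup N] [Module R N] (a : R)
    (P : ProjectiveResolution (ModuleCat.of R M)) :
    a ∈ extAnn R (i + 1) M N ↔
      ∀ f : P.complex.X (i + 1) ⟶ ModuleCat.of R N, P.complex.d (i + 2) (i + 1) ≫ f = 0 →
        ∃ g : P.complex.X i ⟶ ModuleCat.of R N, P.complex.d (i + 1) i ≫ g = a • f := by
  unfold extAnn ExtMod
  rw [(P.isoExt (R := R) (i + 1) (ModuleCat.of R N)).toLinearEquiv.annihilator_eq,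
    HomologicalComplex.homology, (ShortComplex.homologyMapIso ((P.complex.linearYonedaObj R (ModuleCat.of R N)).isoSc'
      i (i + 1) (i + 2) (by simp) (by simp))).toLinearEquiv.annihilator_eq, mem_ann_homology]
  rfl

/-- Comparison with `Abelian.Ext`. -/
lemma mem_extAnn_iff {R : Type u} [CommRing R] (i : ℕ) (M N : Type u)
    [AddCommGroup M] [Module R M] [AddCommGroup N] [Module R N] (a : R) :
    a ∈ extAnn R (i + 1) M N ↔
      ∀ x : Abelian.Ext (ModuleCat.of R M) (ModuleCat.of R N) (i + 1), a • x = 0 := by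
  have P : ProjectiveResolution (ModuleCat.of R M) := projectiveResolution _
  have key : ∀ (f : P.complex.X (i + 1) ⟶ ModuleCat.of R N)
      (hf : P.complex.d (i + 2) (i + 1) ≫ f = 0),
      a • P.extMk f (i + 2) rfl hf = 0 ↔
        ∃ g : P.complex.X i ⟶ ModuleCat.of R N, P.complex.d (i + 1) i ≫ g = a • f := by
    intro f hf
    rw [Abelian.Ext.smul_eq_comp_mk₀, P.extMk_comp_mk₀, P.extMk_eq_zero_iff _ _ _ _ i rfl]
    simp
  rw [mem_extAnn_iff_res i M N a P]
  constructor
  · intro h x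
    obtain ⟨f, hf, rfl⟩ := P.extMk_surjective x (i + 2) rfl
    exact (key f hf).2 (h f hf)
  · intro h f hf
    exact (key f hf).1 (h _)

open Abelian

/-- `a` kills `Ext^i(X, Y)`. -/
def Kills {R : Type u} [CommRing R] (a : R) (i : ℕ) (X Y : ModuleCat.{u} R) : Prop :=
  ∀ x : Abelian.Ext X Y i, a • x = 0

variable {R : Type u} [CommRing R] {a : R}

lemma kills_shift {S : ShortComplex (ModuleCat.{u} R)} (hS : S.ShortExact) [Projective S.X₂]
    {Y : ModuleCat.{u} R} {m : ℕ} (h : Kills a (m + 2) S.X₃ Y) : Kills a (m + 1) S.X₁ Y := by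
  intro x
  obtain ⟨y, hy⟩ := Abelian.Ext.contravariant_sequence_exact₁ hS Y (a • x)
    (n₁ := m + 2) (by lia) (by rw [Abelian.Ext.comp_smul]; exact h _)
  rw [← hy, Abelian.Ext.eq_zero_of_projective y, Abelian.Ext.comp_zero]

lemma factor_left {S : ShortComplex (ModuleCat.{u} R)} (hS : S.ShortExact)
    (h : Kills a 1 S.X₃ S.X₁) : ∃ g : S.X₂ ⟶ S.X₁, S.f ≫ g = a • 𝟙 S.X₁ := by
  obtain ⟨y, hy⟩ := Abelian.Ext.contravariant_sequence_exact₁ hS S.X₁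
    (Abelian.Ext.mk₀ (a • 𝟙 S.X₁)) (n₁ := 1) rfl
    (by rw [← Abelian.Ext.smul_eq_comp_mk₀]; exact h _)
  obtain ⟨g, rfl⟩ := Abelian.Ext.homEquiv₀.symm.surjective y
  refine ⟨g, Abelian.Ext.homEquiv₀.symm.injective ?_⟩
  simpa using hy

lemma factor_right {S : ShortComplex (ModuleCat.{u} R)} (hS : S.ShortExact)
    (h : Kills a 1 S.X₃ S.X₁) : ∃ g : S.X₃ ⟶ S.X₂, g ≫ S.g = a • 𝟙 S.X₃ := by
  obtain ⟨y, hy⟩ := Abelian.Ext.covariant_sequence_exact₃ S.X₃ hS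
    (Abelian.Ext.mk₀ (a • 𝟙 S.X₃)) (n₁ := 1) rfl
    (by rw [Abelian.Ext.mk₀_smul, Abelian.Ext.smul_comp]; exact h _)
  obtain ⟨g, rfl⟩ := Abelian.Ext.homEquiv₀.symm.surjective y
  refine ⟨g, Abelian.Ext.homEquiv₀.symm.injective ?_⟩
  simpa using hy

lemma kills_of_factor {X Y F : ModuleCat.{u} R} [Projective F] (g : X ⟶ F) (h : F ⟶ X)
    (hgh : g ≫ h = a • 𝟙 X) (i : ℕ) : Kills a (i + 1) X Y := by
  intro x
  have : a • x = (Abelian.Ext.mk₀ (a • 𝟙 X)).comp x (zero_add _) := by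
    rw [Abelian.Ext.mk₀_smul, Abelian.Ext.smul_comp, Abelian.Ext.mk₀_id_comp]
  rw [this, ← hgh, ← Abelian.Ext.mk₀_comp_mk₀_assoc,
    Abelian.Ext.eq_zero_of_projective ((Abelian.Ext.mk₀ h).comp x _), Abelian.Ext.comp_zero]

/-- If the identity of `Y` is a finite sum of maps factoring through `Z`s with killed Ext. -/
lemma kills_target {X Y : ModuleCat.{u} R} {i : ℕ} {ι : Type*} [Fintype ι]
    (Z : ι → ModuleCat.{u} R) (p : ∀ j, Y ⟶ Z j) (q : ∀ j, Z j ⟶ Y)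
    (hpq : ∑ j, p j ≫ q j = 𝟙 Y) (h : ∀ j, Kills a i X (Z j)) : Kills a i X Y := by
  intro x
  have e : x = ∑ j, (x.comp (Abelian.Ext.mk₀ (p j)) (add_zero i)).comp
      (Abelian.Ext.mk₀ (q j)) (add_zero i) := by
    conv_lhs => rw [← Abelian.Ext.comp_mk₀_id x, ← hpq, Abelian.Ext.mk₀_sum, Abelian.Ext.comp_sum]
    refine Finset.sum_congr rfl fun j _ => ?_
    rw [Abelian.Ext.comp_assoc_of_third_deg_zero, Abelian.Ext.mk₀_comp_mk₀]
  rw [e, Finset.smul_sum]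
  refine Finset.sum_eq_zero fun j _ => ?_
  rw [← Abelian.Ext.smul_comp, h j, Abelian.Ext.zero_comp]

lemma kills_source {X Y : ModuleCat.{u} R} {i : ℕ} {ι : Type*} [Fintype ι]
    (Z : ι → ModuleCat.{u} R) (p : ∀ j, X ⟶ Z j) (q : ∀ j, Z j ⟶ X)
    (hpq : ∑ j, p j ≫ q j = 𝟙 X) (h : ∀ j, Kills a i (Z j) Y) : Kills a i X Y := by
  intro x
  have e : x = ∑ j, (Abelian.Ext.mk₀ (p j)).comp
      ((Abelian.Ext.mk₀ (q j)).comp x (zero_add i)) (zero_add i) := by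
    conv_lhs => rw [← Abelian.Ext.mk₀_id_comp x, ← hpq, Abelian.Ext.mk₀_sum, Abelian.Ext.sum_comp]
    refine Finset.sum_congr rfl fun j _ => ?_
    rw [Abelian.Ext.mk₀_comp_mk₀_assoc]
  rw [e, Finset.smul_sum]
  refine Finset.sum_eq_zero fun j _ => ?_
  rw [← Abelian.Ext.comp_smul, h j, Abelian.Ext.comp_zero]

lemma proj_of_free (F : Type u) [AddCommGroup F] [Module R F] [Module.Free R F] :
    Projective (ModuleCat.of R F) := inferInstance

/-- A syzygy gives a short exact sequence. -/
lemma IsSyzygy.seq {M S : Type u} [AddCommGroup M] [Module R M] [AddCommGroup S] [Module R S]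
    (h : IsSyzygy R M S) : ∃ (F : ModuleCat.{u} R) (f : ModuleCat.of R S ⟶ F)
      (g : F ⟶ ModuleCat.of R M) (w : f ≫ g = 0),
      (ShortComplex.mk f g w).ShortExact ∧ Projective F := by
  obtain ⟨F, _, _, ι, π, hF, -, hι, hπ, e⟩ := h
  have ex : Function.Exact ι π := LinearMap.exact_iff.2 e.symm
  exact ⟨ModuleCat.of R F, ModuleCat.ofHom ι, ModuleCat.ofHom π,
    ModuleCat.hom_ext ex.linearMap_comp_eq_zero,
    ModuleCat.shortComplex_shortExact _ ex hι hπ, proj_of_free F⟩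

/-- If `a` kills `Ext^n(M, Ω^n M)` then `a` kills all `Ext^{≥1}(Ω^n M, -)`. -/
lemma kills_nthSyzygy (n : ℕ) : ∀ (M P : Type u) [AddCommGroup M] [Module R M]
    [AddCommGroup P] [Module R P] (_ : IsNthSyzygy R (n + 1) M P)
    (_ : Kills a (n + 1) (ModuleCat.of R M) (ModuleCat.of R P)) (i : ℕ) (Y : ModuleCat.{u} R),
    Kills a (i + 1) (ModuleCat.of R P) Y := by
  induction n with
  | zero =>
    intro M P _ _ _ _ hP hk i Y
    obtain ⟨T, _, _, hT, ⟨e⟩⟩ := hP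
    obtain ⟨F, f, g, w, hS, hF⟩ := IsSyzygy.seq hT
    have e' : ModuleCat.of R T ≅ ModuleCat.of R P := e.toModuleIso
    have hk' : Kills a 1 (ModuleCat.of R M) (ModuleCat.of R T) :=
      kills_target (ι := Unit) (fun _ => ModuleCat.of R P) (fun _ => e'.hom) (fun _ => e'.inv)
        (by simp) (fun _ => hk)
    obtain ⟨l, hl⟩ := factor_left hS hk'
    exact kills_source (ι := Unit) (fun _ => ModuleCat.of R T) (fun _ => e'.inv) (fun _ => e'.hom)
        (by simp) (fun _ => kills_of_factor f l hl i)
  | succ n ih =>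
    intro M P _ _ _ _ hP hk i Y
    obtain ⟨T, _, _, hT, hP'⟩ := hP
    obtain ⟨F, f, g, w, hS, hF⟩ := IsSyzygy.seq hT
    exact ih T P hP' (kills_shift (S := ShortComplex.mk f g w) hS hk) i Y

lemma kills_free {X : ModuleCat.{u} R} {i : ℕ} (F : Type u) [AddCommGroup F] [Module R F]
    [Module.Free R F] [Module.Finite R F] (h : Kills a i X (ModuleCat.of R R)) :
    Kills a i X (ModuleCat.of R F) := by
  let b := Module.Free.chooseBasis R F
  refine kills_target (fun _ => ModuleCat.of R R) (fun j => ModuleCat.ofHom (b.coord j))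
    (fun j => ModuleCat.ofHom (LinearMap.toSpanSingleton R F (b j))) ?_ (fun _ => h)
  ext x
  simp

lemma kills_prod {X : ModuleCat.{u} R} {i : ℕ} {A B : Type u} [AddCommGroup A] [Module R A]
    [AddCommGroup B] [Module R B] (hA : Kills a i X (ModuleCat.of R A))
    (hB : Kills a i X (ModuleCat.of R B)) : Kills a i X (ModuleCat.of R (A × B)) := by
  have h1 : ModuleCat.ofHom (LinearMap.fst R A B) ≫ ModuleCat.ofHom (LinearMap.inl R A B) +
      ModuleCat.ofHom (LinearMap.snd R A B) ≫ ModuleCat.ofHom (LinearMap.inr R A B) =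
        𝟙 (ModuleCat.of R (A × B)) := by
    ext x <;> simp
  intro x
  rw [← Abelian.Ext.comp_mk₀_id x, ← h1, Abelian.Ext.mk₀_add, Abelian.Ext.comp_add,
    ← Abelian.Ext.mk₀_comp_mk₀, ← Abelian.Ext.mk₀_comp_mk₀,
    ← Abelian.Ext.comp_assoc_of_third_deg_zero, ← Abelian.Ext.comp_assoc_of_third_deg_zero,
    smul_add, ← Abelian.Ext.smul_comp (x.comp _ _), ← Abelian.Ext.smul_comp (x.comp _ _), hA, hB]
  simp

lemma kills_prod' {X : ModuleCat.{u} R} {i : ℕ} {A B : Type u} [AddCommGroup A] [Module R A]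
    [AddCommGroup B] [Module R B] (hA : Kills a i (ModuleCat.of R A) X)
    (hB : Kills a i (ModuleCat.of R B) X) : Kills a i (ModuleCat.of R (A × B)) X := by
  have h1 : ModuleCat.ofHom (LinearMap.fst R A B) ≫ ModuleCat.ofHom (LinearMap.inl R A B) +
      ModuleCat.ofHom (LinearMap.snd R A B) ≫ ModuleCat.ofHom (LinearMap.inr R A B) =
        𝟙 (ModuleCat.of R (A × B)) := by
    ext x <;> simp
  intro x
  rw [← Abelian.Ext.mk₀_id_comp x, ← h1, Abelian.Ext.mk₀_add, Abelian.Ext.add_comp,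
    ← Abelian.Ext.mk₀_comp_mk₀_assoc, ← Abelian.Ext.mk₀_comp_mk₀_assoc,
    smul_add, ← Abelian.Ext.comp_smul _ (Abelian.Ext.comp _ x _),
    ← Abelian.Ext.comp_smul _ (Abelian.Ext.comp _ x _), hA, hB]
  simp

lemma kills_retract_target {X : ModuleCat.{u} R} {i : ℕ} {A B : Type u} [AddCommGroup A]
    [Module R A] [AddCommGroup B] [Module R B] (p : A →ₗ[R] B) (q : B →ₗ[R] A)
    (h : q ∘ₗ p = LinearMap.id) (hB : Kills a i X (ModuleCat.of R B)) :
    Kills a i X (ModuleCat.of R A) :=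
  kills_target (ι := Unit) (fun _ => ModuleCat.of R B) (fun _ => ModuleCat.ofHom p)
    (fun _ => ModuleCat.ofHom q)
    (by rw [Fintype.sum_unique]; exact ModuleCat.hom_ext h) (fun _ => hB)

lemma kills_retract_source {X : ModuleCat.{u} R} {i : ℕ} {A B : Type u} [AddCommGroup A]
    [Module R A] [AddCommGroup B] [Module R B] (p : A →ₗ[R] B) (q : B →ₗ[R] A)
    (h : q ∘ₗ p = LinearMap.id) (hB : Kills a i (ModuleCat.of R B) X) :
    Kills a i (ModuleCat.of R A) X :=
  kills_source (ι := Unit) (fun _ => ModuleCat.of R B) (fun _ => ModuleCat.ofHom p)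
    (fun _ => ModuleCat.ofHom q)
    (by rw [Fintype.sum_unique]; exact ModuleCat.hom_ext h) (fun _ => hB)

end Stmt10

/-- If `M` has a periodic projective resolution (`Ωⁿ M ≅ M` up to free summands for
some `n ≥ 1`), then the Auslander–Reiten annihilator of `M` equals its stable
annihilator `ann Ext¹(M, ΩM)`. -/
theorem stmt10 (R : Type u) [CommRing R] [IsNoetherianRing R] [IsLocalRing R]
    (M S : Type u) [AddCommGroup M] [Module R M] [Module.Finite R M]
    [AddCommGroup S] [Module R S] (hS : IsSyzygy R M S)
    (n : ℕ) (hn : 1 ≤ n) (P : Type u) [AddCommGroup P] [Module R P]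
    (hP : IsNthSyzygy R n M P)
    (hper : ∃ (F₁ F₂ : Type u) (_ : AddCommGroup F₁) (_ : Module R F₁)
      (_ : AddCommGroup F₂) (_ : Module R F₂),
      Module.Free R F₁ ∧ Module.Finite R F₁ ∧ Module.Free R F₂ ∧ Module.Finite R F₂ ∧
        Nonempty ((P × F₁) ≃ₗ[R] (M × F₂))) :
    ARann R M = extAnn R 1 M S := by
  obtain ⟨F₁, F₂, _, _, _, _, hF₁, _, hF₂, _, ⟨e⟩⟩ := hper
  obtain ⟨n, rfl⟩ : ∃ m, n = m + 1 := ⟨n - 1, by omega⟩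
  ext a
  rw [ARann, Submodule.mem_iInf]
  simp only [Stmt10.mem_extAnn_iff]
  constructor
  · intro h
    have hM : Stmt10.Kills a (n + 1) (ModuleCat.of R M) (ModuleCat.of R M) :=
      Stmt10.kills_retract_target (LinearMap.inl R M R) (LinearMap.fst R M R)
        (by ext; simp) (h n)
    have hR : Stmt10.Kills a (n + 1) (ModuleCat.of R M) (ModuleCat.of R R) :=
      Stmt10.kills_retract_target (LinearMap.inr R M R) (LinearMap.snd R M R)
        (by ext; simp) (h n)
    have hMP : Stmt10.Kills a (n + 1) (ModuleCat.of R M) (ModuleCat.of R P) :=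
      Stmt10.kills_retract_target (e.toLinearMap ∘ₗ LinearMap.inl R P F₁)
        (LinearMap.fst R P F₁ ∘ₗ e.symm.toLinearMap) (by ext; simp)
        (Stmt10.kills_prod hM (Stmt10.kills_free F₂ hR))
    have hP1 := Stmt10.kills_nthSyzygy n M P hP hMP 0 (ModuleCat.of R S)
    have hF1 : Stmt10.Kills a 1 (ModuleCat.of R F₁) (ModuleCat.of R S) := fun x => by
      rw [Abelian.Ext.eq_zero_of_projective x, smul_zero]
    exact Stmt10.kills_retract_source (e.symm.toLinearMap ∘ₗ LinearMap.inl R M F₂)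
        (LinearMap.fst R M F₂ ∘ₗ e.toLinearMap) (by ext; simp)
        (Stmt10.kills_prod' hP1 hF1)
  · intro h i
    obtain ⟨F, f, g, w, hS, hF⟩ := Stmt10.IsSyzygy.seq hS
    obtain ⟨l, hl⟩ := Stmt10.factor_right hS h
    exact Stmt10.kills_of_factor l g hl i
end

section
/- Let R be a commutative Noetherian local ring and suppose M = Ω^r N for some finitely generated R-module N and r sufficiently large so that the ascending chain of stable annihilators of syzygies of N has stabilized. Then for any n > 0, the Auslander–Reiten annihilator of M ⊕ Ω^n M equals its stable annihilator. -/
open CategoryTheory Opposite IsLocalRing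

universe u

variable (R : Type u) [CommRing R]

namespace Stmt11Aux

lemma mem_ann_homology {A : Type u} [CommRing A] (S : ShortComplex (ModuleCat.{u} A)) (a : A) :
    a ∈ Module.annihilator A S.homology ↔
      ∀ x : S.X₂, S.g x = 0 → ∃ y : S.X₁, S.f y = a • x := by
  rw [S.moduleCatHomologyIso.toLinearEquiv.annihilator_eq, Module.mem_annihilator]
  constructor
  · intro h x hx
    have h1 := h (Submodule.Quotient.mk (⟨x, hx⟩ : LinearMap.ker S.g.hom))
    have h2 : (Submodule.Quotient.mk (a • (⟨x, hx⟩ : LinearMap.ker S.g.hom)) :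
      LinearMap.ker S.g.hom ⧸ LinearMap.range S.moduleCatToCycles) = 0 := h1
    rw [Submodule.Quotient.mk_eq_zero] at h2
    obtain ⟨y, hy⟩ := h2
    exact ⟨y, congrArg Subtype.val hy⟩
  · intro h m
    obtain ⟨⟨x, hx⟩, rfl⟩ := Submodule.Quotient.mk_surjective _ m
    obtain ⟨y, hy⟩ := h x hx
    refine (Submodule.Quotient.mk_eq_zero _ (x := a • (⟨x, hx⟩ : LinearMap.ker S.g.hom))).2 ?_
    exact ⟨y, Subtype.ext hy⟩

lemma mem_extAnn_iff_res {A : Type u} [CommRing A] (X Y : Type u) [AddCommGroup X] [Module A X]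
    [AddCommGroup Y] [Module A Y] (P : ProjectiveResolution (ModuleCat.of A X)) (i : ℕ) (a : A) :
    a ∈ extAnn A (i + 1) X Y ↔
      ∀ f : P.complex.X (i + 1) ⟶ ModuleCat.of A Y, P.complex.d (i + 2) (i + 1) ≫ f = 0 →
        ∃ g : P.complex.X i ⟶ ModuleCat.of A Y, P.complex.d (i + 1) i ≫ g = a • f := by
  unfold extAnn ExtMod
  rw [(P.isoExt (R := A) (i + 1) (ModuleCat.of A Y)).toLinearEquiv.annihilator_eq]
  let K := P.complex.linearYonedaObj A (ModuleCat.of A Y)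
  have e : K.homology (i + 1) ≅ (K.sc' i (i + 1) (i + 2)).homology :=
    ShortComplex.homologyMapIso (K.isoSc' i (i + 1) (i + 2) (by simp) (by simp))
  rw [e.toLinearEquiv.annihilator_eq, mem_ann_homology]
  rfl

lemma mem_extAnn_iff {A : Type u} [CommRing A] (X Y : Type u) [AddCommGroup X] [Module A X]
    [AddCommGroup Y] [Module A Y] (i : ℕ) (a : A) :
    a ∈ extAnn A (i + 1) X Y ↔
      ∀ e : Abelian.Ext.{u} (ModuleCat.of A X) (ModuleCat.of A Y) (i + 1), a • e = 0 := by
  let P := projectiveResolution (ModuleCat.of A X)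
  rw [mem_extAnn_iff_res X Y P]
  have key : ∀ (f : P.complex.X (i + 1) ⟶ ModuleCat.of A Y) (hf),
      (a • P.extMk f (i + 2) rfl hf = 0 ↔
        ∃ g : P.complex.X i ⟶ ModuleCat.of A Y, P.complex.d (i + 1) i ≫ g = a • f) := by
    intro f hf
    rw [Abelian.Ext.smul_eq_comp_mk₀, P.extMk_comp_mk₀, P.extMk_eq_zero_iff _ _ _ _ i rfl]
    simp
  constructor
  · intro h e
    obtain ⟨f, hf, rfl⟩ := P.extMk_surjective e (i + 2) rfl
    exact (key f hf).2 (h f hf)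
  · intro h f hf
    exact (key f hf).1 (h _)

/-- maps that factor through a free module -/
lemma mem_stablyTrivial {A : Type u} [CommRing A] {X Y : Type u} [AddCommGroup X] [Module A X]
    [AddCommGroup Y] [Module A Y] {f : X →ₗ[A] Y} (hf : f ∈ stablyTrivial A X Y) :
    ∃ (F : Type u) (_ : AddCommGroup F) (_ : Module A F),
      Module.Free A F ∧ ∃ (g : X →ₗ[A] F) (h : F →ₗ[A] Y), h ∘ₗ g = f := by
  unfold stablyTrivial at hf
  induction hf using Submodule.span_induction with
  | mem x h => exact h
  | zero => exact ⟨PUnit, inferInstance, inferInstance, inferInstance, 0, 0, by simp⟩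
  | add x y _ _ hx hy =>
    obtain ⟨F, _, _, _, g, h, rfl⟩ := hx
    obtain ⟨F', _, _, _, g', h', rfl⟩ := hy
    refine ⟨F × F', inferInstance, inferInstance, inferInstance, g.prod g', h.coprod h', ?_⟩
    ext; simp
  | smul c x _ hx =>
    obtain ⟨F, _, _, _, g, h, rfl⟩ := hx
    exact ⟨F, inferInstance, inferInstance, inferInstance, g, c • h, by ext; simp⟩

lemma stablyTrivial_of_factor {A : Type u} [CommRing A] {X Y F : Type u} [AddCommGroup X]
    [Module A X] [AddCommGroup Y] [Module A Y] [AddCommGroup F] [Module A F] [Module.Free A F]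
    (g : X →ₗ[A] F) (h : F →ₗ[A] Y) : h ∘ₗ g ∈ stablyTrivial A X Y :=
  Submodule.subset_span ⟨F, inferInstance, inferInstance, inferInstance, g, h, rfl⟩

lemma mem_stableAnn_iff {A : Type u} [CommRing A] (X : Type u) [AddCommGroup X] [Module A X]
    (a : A) : a ∈ stableAnn A X ↔ ∃ (F : Type u) (_ : AddCommGroup F) (_ : Module A F),
      Module.Free A F ∧ ∃ (g : X →ₗ[A] F) (h : F →ₗ[A] X), h ∘ₗ g = a • LinearMap.id := by
  unfold stableAnn
  rw [Module.mem_annihilator]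
  constructor
  · intro h
    have h1 := h (Submodule.Quotient.mk LinearMap.id)
    rw [← Submodule.Quotient.mk_smul, Submodule.Quotient.mk_eq_zero] at h1
    exact mem_stablyTrivial h1
  · rintro ⟨F, _, _, _, g, h, hgh⟩ m
    obtain ⟨f, rfl⟩ := Submodule.Quotient.mk_surjective _ m
    rw [← Submodule.Quotient.mk_smul, Submodule.Quotient.mk_eq_zero]
    have : a • f = (f ∘ₗ h) ∘ₗ g := by
      rw [LinearMap.comp_assoc, hgh]; ext; simp
    rw [this]
    exact stablyTrivial_of_factor _ _

lemma stableAnn_prod {A : Type u} [CommRing A] {X Y : Type u} [AddCommGroup X] [Module A X]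
    [AddCommGroup Y] [Module A Y] {a : A} (hX : a ∈ stableAnn A X) (hY : a ∈ stableAnn A Y) :
    a ∈ stableAnn A (X × Y) := by
  rw [mem_stableAnn_iff] at *
  obtain ⟨F, _, _, _, g, h, e⟩ := hX
  obtain ⟨F', _, _, _, g', h', e'⟩ := hY
  refine ⟨F × F', inferInstance, inferInstance, inferInstance, g.prodMap g', h.prodMap h', ?_⟩
  rw [LinearMap.prodMap_comp, e, e']
  ext <;> simp

lemma stableAnn_le_extAnn {A : Type u} [CommRing A] {X Y : Type u} [AddCommGroup X] [Module A X]
    [AddCommGroup Y] [Module A Y] (i : ℕ) : stableAnn A X ≤ extAnn A (i + 1) X Y := by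
  intro a ha
  rw [mem_stableAnn_iff] at ha
  obtain ⟨F, _, _, _, g, h, e⟩ := ha
  rw [mem_extAnn_iff]
  intro x
  have h1 : ModuleCat.ofHom g ≫ ModuleCat.ofHom h = a • 𝟙 (ModuleCat.of A X) := by
    rw [← ModuleCat.ofHom_comp, e]; rfl
  have : a • x = (Abelian.Ext.mk₀ (a • 𝟙 (ModuleCat.of A X))).comp x (zero_add _) := by
    rw [Abelian.Ext.mk₀_smul, Abelian.Ext.smul_comp, Abelian.Ext.mk₀_id_comp]
  have : Projective (ModuleCat.of A F) := (IsProjective.iff_projective F).1 inferInstance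
  rw [‹a • x = _›, ← h1, ← Abelian.Ext.mk₀_comp_mk₀_assoc,
    Abelian.Ext.eq_zero_of_projective ((Abelian.Ext.mk₀ (ModuleCat.ofHom h)).comp x (zero_add _)),
    Abelian.Ext.comp_zero]

/-- `Ext` of retracts. -/
lemma extAnn_prod {A : Type u} [CommRing A] {X X' Y Z : Type u} [AddCommGroup X] [Module A X]
    [AddCommGroup X'] [Module A X'] [AddCommGroup Y] [Module A Y] [AddCommGroup Z] [Module A Z]
    (p : X' →ₗ[A] X) (s : X →ₗ[A] X') (hp : p ∘ₗ s = LinearMap.id)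
    (q : Z →ₗ[A] Y) (t : Y →ₗ[A] Z) (hq : q ∘ₗ t = LinearMap.id)
    (i : ℕ) : extAnn A (i + 1) X' Z ≤ extAnn A (i + 1) X Y := by
  intro a ha
  rw [mem_extAnn_iff] at *
  intro e
  have h1 : ModuleCat.ofHom s ≫ ModuleCat.ofHom p = 𝟙 (ModuleCat.of A X) := by
    rw [← ModuleCat.ofHom_comp, hp]; rfl
  have h2 : ModuleCat.ofHom t ≫ ModuleCat.ofHom q = 𝟙 (ModuleCat.of A Y) := by
    rw [← ModuleCat.ofHom_comp, hq]; rfl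
  have h3 := ha (((Abelian.Ext.mk₀ (ModuleCat.ofHom p)).comp e (zero_add _)).comp
    (Abelian.Ext.mk₀ (ModuleCat.ofHom t)) (add_zero _))
  have h4 := congrArg (fun z => ((Abelian.Ext.mk₀ (ModuleCat.ofHom s)).comp z (zero_add _)).comp
    (Abelian.Ext.mk₀ (ModuleCat.ofHom q)) (add_zero _)) h3
  simpa [Abelian.Ext.comp_assoc_of_third_deg_zero, h1, h2] using h4

/-- The short complex of a syzygy. -/
lemma exists_ses {A : Type u} [CommRing A] {X S : Type u} [AddCommGroup X] [Module A X]
    [AddCommGroup S] [Module A S] (h : IsSyzygy A X S) :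
    ∃ (F : Type u) (_ : AddCommGroup F) (_ : Module A F) (_ : Module.Free A F)
      (f : S →ₗ[A] F) (g : F →ₗ[A] X) (w : ModuleCat.ofHom f ≫ ModuleCat.ofHom g = 0),
      (ShortComplex.mk _ _ w).ShortExact := by
  obtain ⟨F, _, _, f, g, _, _, hf, hg, hfg⟩ := h
  have hex : Function.Exact f g := LinearMap.exact_iff.2 hfg.symm
  refine ⟨F, inferInstance, inferInstance, inferInstance, f, g, ?_, ?_⟩
  · rw [← ModuleCat.ofHom_comp, hex.linearMap_comp_eq_zero]; rfl
  · exact ModuleCat.shortComplex_shortExact _ hex hf hg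

lemma extAnn_shift {A : Type u} [CommRing A] {X S Y : Type u} [AddCommGroup X] [Module A X]
    [AddCommGroup S] [Module A S] [AddCommGroup Y] [Module A Y] (h : IsSyzygy A X S) (i : ℕ) :
    extAnn A (i + 2) X Y ≤ extAnn A (i + 1) S Y := by
  intro a ha
  obtain ⟨F, _, _, _, f, g, w, hS⟩ := exists_ses h
  rw [mem_extAnn_iff] at *
  intro x
  have : Projective (ModuleCat.of A F) := (IsProjective.iff_projective F).1 inferInstance
  obtain ⟨y, hy⟩ := Abelian.Ext.contravariant_sequence_exact₁ hS (ModuleCat.of A Y) (a • x)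
    (n₁ := i + 1 + 1) (add_comm _ _) (by rw [Abelian.Ext.comp_smul]; exact ha _)
  rw [← hy]
  rw [Abelian.Ext.eq_zero_of_projective (P := ModuleCat.of A F) y, Abelian.Ext.comp_zero]

lemma extAnn_one_le {A : Type u} [CommRing A] {X S : Type u} [AddCommGroup X] [Module A X]
    [AddCommGroup S] [Module A S] (h : IsSyzygy A X S) :
    extAnn A 1 X S ≤ stableAnn A X := by
  intro a ha
  obtain ⟨F, _, _, _, f, g, w, hS⟩ := exists_ses h
  rw [mem_extAnn_iff] at ha
  obtain ⟨y, hy⟩ := Abelian.Ext.covariant_sequence_exact₃ (ModuleCat.of A X) hS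
    (Abelian.Ext.mk₀ (a • 𝟙 (ModuleCat.of A X))) (n₁ := 1) (zero_add _) (by
      rw [Abelian.Ext.mk₀_smul, Abelian.Ext.smul_comp]
      exact ha _)
  obtain ⟨y, rfl⟩ := (Abelian.Ext.mk₀_bijective _ _).2 y
  rw [Abelian.Ext.mk₀_comp_mk₀] at hy
  have hy := (Abelian.Ext.mk₀_bijective _ _).1 hy
  rw [mem_stableAnn_iff]
  exact ⟨F, inferInstance, inferInstance, inferInstance, y.hom, g, congrArg ModuleCat.Hom.hom hy⟩

lemma isSyzygy_of_equiv {A : Type u} [CommRing A] {X S S' : Type u} [AddCommGroup X] [Module A X]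
    [AddCommGroup S] [Module A S] [AddCommGroup S'] [Module A S'] (h : IsSyzygy A X S)
    (e : S ≃ₗ[A] S') : IsSyzygy A X S' := by
  obtain ⟨F, _, _, f, g, h1, h2, hf, hg, hfg⟩ := h
  refine ⟨F, inferInstance, inferInstance, f ∘ₗ e.symm.toLinearMap, g, h1, h2, ?_, hg, ?_⟩
  · exact hf.comp e.symm.injective
  · rw [LinearMap.range_comp_of_range_eq_top _ e.symm.range, hfg]

/-- `Ext^{n+1}(X, Ω^{n+1} X)` controls the stable annihilator of `Ω^n X`. -/
lemma exists_penultimate {A : Type u} [CommRing A] (n : ℕ) :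
    ∀ (X T : Type u) [AddCommGroup X] [Module A X] [AddCommGroup T] [Module A T],
    IsNthSyzygy A (n + 1) X T → ∃ (S : Type u) (_ : AddCommGroup S) (_ : Module A S),
      IsNthSyzygy A n X S ∧ extAnn A (n + 1) X T ≤ stableAnn A S := by
  induction n with
  | zero =>
    intro X T _ _ _ _ h
    obtain ⟨S, _, _, hS, ⟨e⟩⟩ := h
    exact ⟨X, inferInstance, inferInstance, ⟨LinearEquiv.refl A X⟩,
      extAnn_one_le (isSyzygy_of_equiv hS e)⟩
  | succ n ih =>
    intro X T _ _ _ _ h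
    obtain ⟨S, _, _, hS, hT⟩ := h
    obtain ⟨U, _, _, hU, hle⟩ := ih S T hT
    exact ⟨U, inferInstance, inferInstance, ⟨S, inferInstance, inferInstance, hS, hU⟩,
      (extAnn_shift hS n).trans hle⟩

end Stmt11Aux

/-- If `M = Ω^r N` with `r` large enough that the chain of stable annihilators of the
syzygies of `N` has stabilized, then for any `n > 0` the Auslander–Reiten annihilator
of `M ⊕ Ωⁿ M` equals its stable annihilator. -/
theorem stmt11 (R : Type u) [CommRing R] [IsNoetherianRing R] [IsLocalRing R]
    (N M : Type u) [AddCommGroup N] [Module R N] [Module.Finite R N]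
    [AddCommGroup M] [Module R M]
    (r : ℕ) (hM : IsNthSyzygy R r N M)
    (hstab : ∀ (s : ℕ) (T : Type u) (_ : AddCommGroup T) (_ : Module R T),
      IsNthSyzygy R s M T → stableAnn R T = stableAnn R M)
    (n : ℕ) (hn : 0 < n)
    (T : Type u) [AddCommGroup T] [Module R T] (hT : IsNthSyzygy R n M T) :
    ARann R (M × T) = stableAnn R (M × T) := by
  apply le_antisymm
  · intro a ha
    have h1 : a ∈ stableAnn R M := by
      obtain ⟨m, rfl⟩ : ∃ m, n = m + 1 := ⟨n - 1, by omega⟩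
      obtain ⟨S, _, _, hS, hle⟩ := Stmt11Aux.exists_penultimate m M T hT
      rw [← hstab m S _ _ hS]
      apply hle
      have h2 : a ∈ extAnn R (m + 1) (M × T) ((M × T) × R) := (Submodule.mem_iInf _).1 ha m
      refine Stmt11Aux.extAnn_prod (LinearMap.fst R M T) (LinearMap.inl R M T) ?_
        (LinearMap.snd R M T ∘ₗ LinearMap.fst R (M × T) R)
        (LinearMap.inl R (M × T) R ∘ₗ LinearMap.inr R M T) ?_ m h2
      · ext; simp
      · ext; simp
    exact Stmt11Aux.stableAnn_prod h1 (by rw [hstab n T _ _ hT]; exact h1)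
  · exact le_iInf fun i => Stmt11Aux.stableAnn_le_extAnn i
end

section
/- Let R ⊂ S ⊆ Q(R) be a finite ring extension of a commutative Noetherian local ring R inside its total quotient ring. Then the conductor c(S/R) = {x ∈ R : xS ⊆ R} equals the stable annihilator of S as an R-module, and there is an R-module isomorphism S/c(S/R) ≅ End_R(S)/P(S,S). -/
open CategoryTheory Opposite IsLocalRing

universe u

variable (R : Type u) [CommRing R]

/-- The conductor of a ring extension `R → A`: elements `x` of `R` with `xA ⊆ R`. -/
def conductorIdeal (A : Type u) [CommRing A] [Algebra R A] : Ideal R where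
  carrier := {x : R | ∀ a : A, algebraMap R A x * a ∈ (algebraMap R A).range}
  zero_mem' := by intro a; exact ⟨0, by simp⟩
  add_mem' := fun ha hb a => by
    rw [map_add, add_mul]; exact add_mem (ha a) (hb a)
  smul_mem' := fun c x hx a => by
    rw [smul_eq_mul, map_mul, mul_assoc]
    exact mul_mem (RingHom.mem_range_self _ c) (hx a)

section helpers

variable {R} {S : Type u} [CommRing S] [Algebra R S]

theorem endo_eq_mul (j : S →ₐ[R] FractionRing R) (hj : Function.Injective j)
    (f : S →ₗ[R] S) (s : S) : f s = f 1 * s := by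
  obtain ⟨⟨a, b⟩, hab⟩ := IsLocalization.surj (nonZeroDivisors R) (j s)
  simp only at hab
  have h1 : algebraMap R S b * s = algebraMap R S a := by
    apply hj
    rw [map_mul, AlgHom.commutes, AlgHom.commutes, mul_comm]
    exact hab
  have h2 : algebraMap R S b * f s = algebraMap R S b * (f 1 * s) := by
    calc algebraMap R S b * f s = f (algebraMap R S b * s) := by
          rw [← Algebra.smul_def, ← Algebra.smul_def, map_smul]
      _ = f (algebraMap R S a) := by rw [h1]
      _ = algebraMap R S a * f 1 := by
          rw [Algebra.algebraMap_eq_smul_one, map_smul, smul_mul_assoc, one_mul]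
      _ = _ := by rw [← h1]; ring
  have h3 := congrArg j h2
  rw [map_mul, map_mul, AlgHom.commutes] at h3
  exact hj ((IsLocalization.map_units (FractionRing R) b).mul_left_cancel h3)

/-- Multiplication identifies `S` with its `R`-linear endomorphisms. -/
noncomputable def mulEquivEnd (j : S →ₐ[R] FractionRing R) (hj : Function.Injective j) :
    (S →ₗ[R] S) ≃ₗ[R] S where
  toFun f := f 1
  map_add' _ _ := rfl
  map_smul' _ _ := rfl
  invFun s := LinearMap.mulLeft R s
  left_inv f := by
    ext s
    simp [endo_eq_mul j hj f s]
  right_inv s := by simp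

theorem apply_one_mem_conductor (j : S →ₐ[R] FractionRing R) (hj : Function.Injective j)
    (g : S →ₗ[R] R) : g 1 ∈ conductorIdeal R S := by
  intro a
  have := endo_eq_mul j hj ((Algebra.linearMap R S) ∘ₗ g) a
  simp only [LinearMap.comp_apply, Algebra.linearMap_apply] at this
  exact ⟨g a, this⟩

theorem map_stablyTrivial (hinj : Function.Injective (algebraMap R S))
    (j : S →ₐ[R] FractionRing R) (hj : Function.Injective j) :
    (stablyTrivial R S S).map (mulEquivEnd j hj : (S →ₗ[R] S) →ₗ[R] S) =
      conductorIdeal R S • (⊤ : Submodule R S) := by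
  apply le_antisymm
  · rw [stablyTrivial, Submodule.map_span_le]
    rintro f ⟨F, _, _, hF, g, h, rfl⟩
    change h (g 1) ∈ _
    let b := Module.Free.chooseBasis R F
    rw [← b.linearCombination_repr (g 1), Finsupp.linearCombination_apply, Finsupp.sum, map_sum]
    refine Submodule.sum_mem _ fun i _ => ?_
    rw [map_smul]
    exact Submodule.smul_mem_smul
      (apply_one_mem_conductor j hj (b.coord i ∘ₗ g)) Submodule.mem_top
  · rw [Submodule.smul_le]
    intro x hx s _
    choose g hg using hx
    let G : S →ₗ[R] R :=
      { toFun := g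
        map_add' := fun a b => hinj (by rw [map_add, hg, hg, hg, mul_add])
        map_smul' := fun r a => hinj (by
          simp only [RingHom.id_apply, smul_eq_mul, map_mul, hg, Algebra.smul_def]; ring) }
    refine ⟨LinearMap.toSpanSingleton R S s ∘ₗ G, Submodule.subset_span
      ⟨R, inferInstance, inferInstance, inferInstance, G, _, rfl⟩, ?_⟩
    change g 1 • s = x • s
    rw [Algebra.smul_def, hg, mul_one, Algebra.smul_def]

theorem conductor_smul_top_le :
    conductorIdeal R S • (⊤ : Submodule R S) ≤ LinearMap.range (Algebra.linearMap R S) := by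
  rw [Submodule.smul_le]
  intro x hx s _
  obtain ⟨r, hr⟩ := hx s
  exact ⟨r, by rw [Algebra.smul_def]; exact hr⟩

end helpers

/-- For a finite ring extension `R ⊂ S ⊆ Q(R)` inside the total quotient ring of `R`,
the conductor `c(S/R)` equals the stable annihilator of `S` as an `R`-module, and
`S/c(S/R) ≅ End_R(S)/P(S,S)` as `R`-modules. -/
theorem stmt12 (R : Type u) [CommRing R] [IsNoetherianRing R] [IsLocalRing R]
    (S : Type u) [CommRing S] [Algebra R S] [Module.Finite R S]
    (hinj : Function.Injective (algebraMap R S))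
    (hstrict : ¬ Function.Surjective (algebraMap R S))
    (hsub : ∃ j : S →ₐ[R] FractionRing R, Function.Injective j) :
    conductorIdeal R S = stableAnn R S ∧
      Nonempty ((S ⧸ (conductorIdeal R S • (⊤ : Submodule R S))) ≃ₗ[R]
        ((S →ₗ[R] S) ⧸ stablyTrivial R S S)) := by
  obtain ⟨j, hj⟩ := hsub
  have hmap := map_stablyTrivial hinj j hj
  let e := Submodule.Quotient.equiv _ _ (mulEquivEnd j hj) hmap
  refine ⟨?_, ⟨e.symm⟩⟩
  rw [stableAnn, e.annihilator_eq]
  ext x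
  rw [Submodule.annihilator_quotient, Submodule.mem_colon]
  constructor
  · intro hx s _
    exact Submodule.smul_mem_smul hx Submodule.mem_top
  · intro hx a
    obtain ⟨r, hr⟩ := conductor_smul_top_le (hx a (Set.mem_univ a))
    exact ⟨r, by rw [← Algebra.smul_def]; exact hr⟩
end
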